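/- arXiv:1104.2099 — 3 statements merged into one kernel-verified Lean document; each statement's English description precedes it below -/
import Mathlib

section
/- Let 1 ≤ s < t be fixed integers. There exists m₀ such that for all m ≥ m₀ there exists a balanced bipartite graph G on 2n = 2m(s+t) vertices with δ(G) = n/2 + s − 2 if m is even, and δ(G) = (n+t+s)/2 − 2 if m is odd and t ≤ 2s+1, such that G cannot be tiled with K_{s,t}. -/
open scoped Classical
open Finset

namespace PaperTiling

variable {V : Type*} [Fintype V] [DecidableEq V]

/-- The number of neighbours of `v` inside the set `S`. -/
noncomputable def degS (G : SimpleGraph V) (v : V) (S : Finset V) : ℕ :=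
  (S.filter fun w => G.Adj v w).card

/-- The number of edges of `G` with one end in `A` and the other in `B`. -/
noncomputable def eAB (G : SimpleGraph V) (A B : Finset V) : ℕ :=
  ∑ v ∈ A, degS G v B

/-- The edge density `d(A,B) = e(A,B)/(|A||B|)`. -/
noncomputable def dens (G : SimpleGraph V) (A B : Finset V) : ℝ :=
  (eAB G A B : ℝ) / ((A.card : ℝ) * (B.card : ℝ))

/-- `G` is a bipartite graph with parts `A` and `B`. -/
def IsBipartition (G : SimpleGraph V) (A B : Finset V) : Prop :=
  Disjoint A B ∧ A ∪ B = Finset.univ ∧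
    ∀ u v : V, G.Adj u v → (u ∈ A ∧ v ∈ B) ∨ (u ∈ B ∧ v ∈ A)

/-- `(S, T)` spans a copy of the complete bipartite graph `K_{s,t}` in `G`,
with `S` the side of size `s` and `T` the side of size `t`. -/
def IsKst (G : SimpleGraph V) (s t : ℕ) (S T : Finset V) : Prop :=
  Disjoint S T ∧ S.card = s ∧ T.card = t ∧ ∀ u ∈ S, ∀ v ∈ T, G.Adj u v

/-- `𝒯` is a perfect `K_{s,t}`-tiling of `G`: a collection of pairwise
vertex-disjoint copies of `K_{s,t}` covering all vertices. -/
def IsKstTiling (G : SimpleGraph V) (s t : ℕ)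
    (𝒯 : Finset (Finset V × Finset V)) : Prop :=
  (∀ P ∈ 𝒯, IsKst G s t P.1 P.2) ∧
  (𝒯 : Set (Finset V × Finset V)).PairwiseDisjoint (fun P => P.1 ∪ P.2) ∧
  𝒯.sup (fun P => P.1 ∪ P.2) = Finset.univ

/-- `G` can be tiled with `K_{s,t}`. -/
def KstTileable (G : SimpleGraph V) (s t : ℕ) : Prop :=
  ∃ 𝒯 : Finset (Finset V × Finset V), IsKstTiling G s t 𝒯

/-- `G` can be tiled with the complete graph `K_s`. -/
def CliqueTileable (G : SimpleGraph V) (s : ℕ) : Prop :=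
  ∃ 𝒞 : Finset (Finset V),
    (∀ S ∈ 𝒞, S.card = s ∧ G.IsClique (S : Set V)) ∧
    (𝒞 : Set (Finset V)).PairwiseDisjoint id ∧
    𝒞.sup id = Finset.univ

/-- The minimum degree of `G` equals the real number `c`. -/
def MinDegreeIs (G : SimpleGraph V) (c : ℝ) : Prop :=
  (∀ v : V, c ≤ (degS G v Finset.univ : ℝ)) ∧
  ∃ v : V, (degS G v Finset.univ : ℝ) = c

/-- `(c, L)` is an `h`-star with centre `c ∈ A` and `h` leaves `L ⊆ B`. -/
def IsStar (G : SimpleGraph V) (h : ℕ) (A B : Finset V) (c : V) (L : Finset V) : Prop :=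
  c ∈ A ∧ L ⊆ B ∧ L.card = h ∧ ∀ v ∈ L, G.Adj c v

/-- `𝒮` is a family of pairwise vertex-disjoint `h`-stars from `A` to `B`. -/
def StarFamily (G : SimpleGraph V) (h : ℕ) (A B : Finset V)
    (𝒮 : Finset (V × Finset V)) : Prop :=
  (∀ S ∈ 𝒮, IsStar G h A B S.1 S.2) ∧
  (𝒮 : Set (V × Finset V)).PairwiseDisjoint (fun S => insert S.1 S.2)

/-- The structure hypotheses (H) for the extremal construction of the paper:
`1 ≤ s < t`, `t ≥ 2s+1`, `k ≥ 1`, `G` is bipartite with parts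
`U₀ ∪ U₁ ∪ U₂` and `V₀ ∪ V₁ ∪ V₂`, with the prescribed part sizes,
complete pairs `(U₁,V₁)`, `(U₂,V₂)`, `(U₀, V₁∪V₂)`, `(V₀, U₁∪U₂)`,
no edges between `U₀` and `V₀`, and sparse `K_{2,2}`-free diagonal pairs. -/
structure StructH (G : SimpleGraph V) (s t k : ℕ)
    (U0 U1 U2 V0 V1 V2 : Finset V) : Prop where
  hs : 1 ≤ s
  hst : s < t
  ht : 2 * s + 1 ≤ t
  hk : 1 ≤ k
  bip : IsBipartition G (U0 ∪ U1 ∪ U2) (V0 ∪ V1 ∪ V2)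
  hU01 : Disjoint U0 U1
  hU02 : Disjoint U0 U2
  hU12 : Disjoint U1 U2
  hV01 : Disjoint V0 V1
  hV02 : Disjoint V0 V2
  hV12 : Disjoint V1 V2
  cardU0 : U0.card = s - 1
  cardV0 : V0.card = s - 1
  cardU1 : U1.card = k * (s + t) + (t + 1) / 2
  cardV2 : V2.card = k * (s + t) + (t + 1) / 2
  cardV1 : V1.card = k * (s + t) + (t + 2) / 2
  cardU2 : U2.card = k * (s + t) + (t + 2) / 2
  compU1V1 : ∀ u ∈ U1, ∀ v ∈ V1, G.Adj u v
  compU2V2 : ∀ u ∈ U2, ∀ v ∈ V2, G.Adj u v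
  compU0 : ∀ u ∈ U0, ∀ v ∈ V1 ∪ V2, G.Adj u v
  compV0 : ∀ v ∈ V0, ∀ u ∈ U1 ∪ U2, G.Adj u v
  emptyU0V0 : ∀ u ∈ U0, ∀ v ∈ V0, ¬ G.Adj u v
  K22freeU1V2 : ∀ S T : Finset V, S ⊆ U1 → T ⊆ V2 → ¬ IsKst G 2 2 S T
  K22freeU2V1 : ∀ S T : Finset V, S ⊆ U2 → T ⊆ V1 → ¬ IsKst G 2 2 S T
  degU1 : ∀ u ∈ U1, degS G u V2 ≤ s - 1
  degU2 : ∀ u ∈ U2, degS G u V1 ≤ s - 1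
  degV1 : ∀ v ∈ V1, degS G v U2 ≤ s - 1
  degV2 : ∀ v ∈ V2, degS G v U1 ≤ s - 1

/-- The vertex set `W` of a copy of `K_{s,t}` is crossing. -/
def Crossing (U1 V1 U2 V2 W : Finset V) : Prop :=
  (W ∩ (U1 ∪ V1)).Nonempty ∧ (W ∩ (U2 ∪ V2)).Nonempty

/-- `W` is crossing from the set `A`, where `AD = A^D` is the diagonal set of `A`
and `AM = A^M` is the opposite middle set of `A`. -/
def CrossingFrom (W A AD AM : Finset V) : Prop :=
  (W ∩ A).card = 1 ∧
    (2 ≤ (W ∩ AD).card ∨ ((W ∩ AD).card = 1 ∧ (W ∩ AM).Nonempty))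

/-- `W` is of Type 1 (crossing from `A`), where `AD = A^D`, `AN = A^N`,
`ANM = (A^N)^M`. -/
def Type1From (s t : ℕ) (W AD AN ANM : Finset V) : Prop :=
  ∃ p : ℕ, 2 ≤ p ∧ p ≤ s - 1 ∧ (W ∩ ANM).card = s - 1 ∧
    (W ∩ AN).card = t - p ∧ (W ∩ AD).card = p

/-- `W` is of Type 2 (crossing from `A`), where `AD = A^D`, `AM = A^M`,
`AND = (A^N)^D`. -/
def Type2From (s t : ℕ) (W AD AM AND : Finset V) : Prop :=
  ∃ p : ℕ, 1 ≤ p ∧ p ≤ s - 1 ∧ (W ∩ AND).card = t - 1 ∧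
    (W ∩ AM).card = s - p ∧ (W ∩ AD).card = p

/-! ### Sparse regular bipartite graphs without four-cycles -/

theorem two_pow_add_two_pow_of_le {a b c d : ℕ} (hba : b ≤ a) (hdc : d ≤ c)
    (h : 2 ^ a + 2 ^ b = 2 ^ c + 2 ^ d) : a = c ∧ b = d := by
  have key : ∀ {a b c d : ℕ}, d ≤ c → 2 ^ a + 2 ^ b = 2 ^ c + 2 ^ d → a ≤ c := by
    intro a b c d hdc h
    by_contra! hca
    have h1 : 2 ^ d ≤ 2 ^ c := Nat.pow_le_pow_right two_pos hdc
    have h2 : 2 ^ (c + 1) ≤ 2 ^ a := Nat.pow_le_pow_right two_pos hca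
    have h3 : 0 < 2 ^ b := Nat.two_pow_pos b
    rw [pow_succ] at h2
    omega
  obtain rfl : a = c := le_antisymm (key hdc h) (key hba h.symm)
  exact ⟨rfl, Nat.pow_right_injective le_rfl (by simpa using h)⟩

/-- The powers of two form a Sidon set. -/
theorem two_pow_add_two_pow {a b c d : ℕ} (h : 2 ^ a + 2 ^ b = 2 ^ c + 2 ^ d) :
    a = c ∨ a = d := by
  rcases le_total b a with h1 | h1 <;> rcases le_total d c with h2 | h2
  · exact .inl (two_pow_add_two_pow_of_le h1 h2 h).1
  · exact .inr (two_pow_add_two_pow_of_le h1 h2 (by omega)).1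
  · exact .inr (two_pow_add_two_pow_of_le h1 h2 (by omega)).2
  · exact .inl (two_pow_add_two_pow_of_le h1 h2 (by omega)).2

theorem exists_sidon_zmod (d N : ℕ) (hN : 2 ^ (d + 1) < N) :
    ∃ D : Finset (ZMod N), D.card = d ∧
      ∀ x ∈ D, ∀ y ∈ D, ∀ z ∈ D, ∀ w ∈ D, x + y = z + w → x = z ∨ x = w := by
  have hlt : ∀ a < d, 2 ^ a < 2 ^ d := fun a ha => Nat.pow_lt_pow_right (by norm_num) ha
  rw [pow_succ] at hN
  have hcast : ∀ m n : ℕ, m < N → n < N → (m : ZMod N) = n → m = n := by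
    intro m n hm hn h
    rw [ZMod.natCast_eq_natCast_iff'] at h
    rwa [Nat.mod_eq_of_lt hm, Nat.mod_eq_of_lt hn] at h
  refine ⟨(range d).image fun a => ((2 ^ a : ℕ) : ZMod N), ?_, ?_⟩
  · rw [card_image_of_injOn, card_range]
    intro a ha b hb h
    have ha' := hlt a (by simpa using ha)
    have hb' := hlt b (by simpa using hb)
    exact Nat.pow_right_injective le_rfl (hcast (2 ^ a) (2 ^ b) (by omega) (by omega) h)
  · simp only [mem_image, mem_range]
    rintro _ ⟨a, ha, rfl⟩ _ ⟨b, hb, rfl⟩ _ ⟨e, he, rfl⟩ _ ⟨f, hf, rfl⟩ h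
    have := hlt a ha
    have := hlt b hb
    have := hlt e he
    have := hlt f hf
    rw [← Nat.cast_add, ← Nat.cast_add] at h
    rcases two_pow_add_two_pow (hcast _ _ (by omega) (by omega) h) with rfl | rfl
    · exact .inl rfl
    · exact .inr rfl

/-- A `d`-regular `K_{2,2}`-free bipartite relation on two copies of `Fin N`. -/
theorem exists_regular_K22free (d N : ℕ) (hN : 2 ^ (d + 1) < N) :
    ∃ R : Fin N → Fin N → Prop,
      (∀ i, (univ.filter fun j => R i j).card = d) ∧
      (∀ j, (univ.filter fun i => R i j).card = d) ∧
      ∀ i i' j j', R i j → R i j' → R i' j → R i' j' → i = i' ∨ j = j' := by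
  obtain ⟨D, hD, hsidon⟩ := exists_sidon_zmod d N hN
  have : NeZero N := ⟨(Nat.zero_lt_of_lt hN).ne'⟩
  let e : Fin N ≃ ZMod N := (ZMod.finEquiv N).toEquiv
  refine ⟨fun i j => e j - e i ∈ D, fun i => ?_, fun j => ?_, ?_⟩
  · rw [← hD]
    refine card_bij (fun j _ => e j - e i) (by simp) (by simp) fun x hx => ?_
    exact ⟨e.symm (x + e i), by simpa using hx, by simp⟩
  · rw [← hD]
    refine card_bij (fun i _ => e j - e i) (by simp) (by simp) fun x hx => ?_
    exact ⟨e.symm (e j - x), by simpa using hx, by simp⟩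
  · intro i i' j j' h1 h2 h3 h4
    rcases hsidon _ h1 _ h4 _ h2 _ h3 (by ring) with h | h
    · exact .inr (e.injective (by simpa using h))
    · exact .inl (e.injective (by simpa using h))

/-! ### Counting obstruction to a tiling -/

/-- The parts of a copy of `K_{s,t}`, split into the classes `0, 1, 2`, lie essentially in one of
the classes `1`, `2`: the excess is paid for by vertices in class `0`. -/
theorem copy_side {s t c x0 x1 x2 y0 y1 y2 : ℕ} (hst : s < t)
    (hc : c = 0 ∨ (t = c + s + 2 ∧ c + 1 ≤ s))
    (hxy : (x0 + x1 + x2 = s ∧ y0 + y1 + y2 = t) ∨ (x0 + x1 + x2 = t ∧ y0 + y1 + y2 = s))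
    (hx0 : x0 ≤ c) (hy0 : y0 ≤ c) (h00 : x0 = 0 ∨ y0 = 0)
    (hx1 : x1 = 0 ∨ y2 + 1 ≤ s) (hx2 : x2 = 0 ∨ y1 + 1 ≤ s)
    (hy1 : y1 = 0 ∨ x2 + 1 ≤ s) (hy2 : y2 = 0 ∨ x1 + 1 ≤ s)
    (h12 : x1 ≤ 1 ∨ y2 ≤ 1) (h21 : x2 ≤ 1 ∨ y1 ≤ 1) :
    (y2 ≤ x0 ∧ x2 ≤ y0) ∨ (y1 ≤ x0 ∧ x1 ≤ y0) := by
  omega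

theorem sum_eq_count {ι : Type*} (F : Finset ι) (f g : ι → ℕ) (s t : ℕ)
    (h : ∀ P ∈ F, (f P = s ∧ g P = t) ∨ (f P = t ∧ g P = s)) :
    ∃ p q : ℕ, ∑ P ∈ F, f P = p * s + q * t ∧ ∑ P ∈ F, g P = p * t + q * s := by
  induction F using Finset.induction_on with
  | empty => exact ⟨0, 0, by simp⟩
  | insert a F ha ih =>
    obtain ⟨p, q, hp, hq⟩ := ih fun P hP => h P (mem_insert_of_mem hP)
    rw [sum_insert ha, sum_insert ha, hp, hq]
    rcases h a (mem_insert_self a F) with ⟨h1, h2⟩ | ⟨h1, h2⟩ <;> rw [h1, h2]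
    · exact ⟨p + 1, q, by ring, by ring⟩
    · exact ⟨p, q + 1, by ring, by ring⟩

/-- The class sizes of the extremal constructions. -/
def ExtremalSizes (s t c a b : ℕ) : Prop :=
  (c = 0 ∧ ¬ (s + t) ∣ 2 * a) ∨
    (t = c + s + 2 ∧ c + 1 ≤ s ∧ b = a ∧ ∃ k, a = k * (s + t) + s + 1)

/-- The arithmetic obstruction, in terms of the numbers of vertices of each class covered by
the copies lying on side `1` (first six numbers) and on side `2` (last six numbers). -/
theorem sizes_obstruction {s t c a b : ℕ} (hst : s < t) (hsize : ExtremalSizes s t c a b)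
    {x0 x1 x2 y0 y1 y2 x0' x1' x2' y0' y1' y2' p q p' q' : ℕ}
    (hx0 : x0 + x0' = c) (hx1 : x1 + x1' = a) (hx2 : x2 + x2' = b)
    (hy0 : y0 + y0' = c) (hy1 : y1 + y1' = a) (hy2 : y2 + y2' = b)
    (hx : x0 + x1 + x2 = p * s + q * t) (hy : y0 + y1 + y2 = p * t + q * s)
    (hx' : x0' + x1' + x2' = p' * s + q' * t) (hy' : y0' + y1' + y2' = p' * t + q' * s)
    (h1 : y2 ≤ x0) (h2 : x2 ≤ y0) (h3 : y1' ≤ x0') (h4 : x1' ≤ y0') : False := by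
  rcases hsize with ⟨rfl, hdvd⟩ | ⟨ht, hcs, rfl, k, hk⟩
  · refine hdvd ⟨p + q, ?_⟩
    have : (s + t) * (p + q) = (p * s + q * t) + (p * t + q * s) := by ring
    omega
  · have e1 : (p + q) * (s + t) = (p * s + q * t) + (p * t + q * s) := by ring
    have e2 : (p' + q') * (s + t) = (p' * s + q' * t) + (p' * t + q' * s) := by ring
    have e3 : (2 * k + 2) * (s + t) = 2 * (k * (s + t)) + 2 * (s + t) := by ring
    have l1 : p + q < 2 * k + 2 := lt_of_mul_lt_mul_right (a := s + t) (by omega) (by omega)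
    have l2 : p' + q' < 2 * k + 2 := lt_of_mul_lt_mul_right (a := s + t) (by omega) (by omega)
    have e4 : (p + q + (p' + q')) * (s + t) = (p + q) * (s + t) + (p' + q') * (s + t) := by ring
    have e5 : (4 * k + 2) * (s + t) = 4 * (k * (s + t)) + 2 * (s + t) := by ring
    have l3 : p + q + (p' + q') = 4 * k + 2 :=
      Nat.eq_of_mul_eq_mul_right (show 0 < s + t by omega) (by omega)
    obtain ⟨r, rfl⟩ : ∃ r, t = s + r := ⟨t - s, by omega⟩
    have f1 : p * s + q * (s + r) = (p + q) * s + q * r := by ring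
    have f2 : p * (s + r) + q * s = (p + q) * s + p * r := by ring
    have hpq : p + q = 2 * k + 1 := by omega
    have f3 : k * (s + (s + r)) = 2 * k * s + k * r := by ring
    have f4 : (2 * k + 1) * s = 2 * k * s + s := by ring
    have f5 : (k + 1) * r = k * r + r := by ring
    rw [hpq] at f1 f2
    rcases le_or_gt q k with hq | hq
    · have g1 : q * r ≤ k * r := Nat.mul_le_mul_right r hq
      have g2 : (k + 1) * r ≤ p * r := Nat.mul_le_mul_right r (by omega)
      omega
    · have g1 : p * r ≤ k * r := Nat.mul_le_mul_right r (by omega)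
      have g2 : (k + 1) * r ≤ q * r := Nat.mul_le_mul_right r (by omega)
      omega

theorem no_weighted_tiling {ι : Type*} (F : Finset ι) (x y : Fin 3 → ι → ℕ) {s t c a b : ℕ}
    (hst : s < t) (hsize : ExtremalSizes s t c a b)
    (hcard : ∀ P ∈ F, (x 0 P + x 1 P + x 2 P = s ∧ y 0 P + y 1 P + y 2 P = t) ∨
      (x 0 P + x 1 P + x 2 P = t ∧ y 0 P + y 1 P + y 2 P = s))
    (hside : ∀ P ∈ F, (y 2 P ≤ x 0 P ∧ x 2 P ≤ y 0 P) ∨ (y 1 P ≤ x 0 P ∧ x 1 P ≤ y 0 P))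
    (hx0 : ∑ P ∈ F, x 0 P = c) (hx1 : ∑ P ∈ F, x 1 P = a) (hx2 : ∑ P ∈ F, x 2 P = b)
    (hy0 : ∑ P ∈ F, y 0 P = c) (hy1 : ∑ P ∈ F, y 1 P = a) (hy2 : ∑ P ∈ F, y 2 P = b) :
    False := by
  set F₁ := F.filter fun P => y 2 P ≤ x 0 P ∧ x 2 P ≤ y 0 P with hF₁
  set F₂ := F.filter fun P => ¬ (y 2 P ≤ x 0 P ∧ x 2 P ≤ y 0 P) with hF₂
  have hF : ∀ f : ι → ℕ, ∑ P ∈ F₁, f P + ∑ P ∈ F₂, f P = ∑ P ∈ F, f P :=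
    fun f => sum_filter_add_sum_filter_not F _ f
  have m₁ : ∀ P ∈ F₁, P ∈ F ∧ y 2 P ≤ x 0 P ∧ x 2 P ≤ y 0 P := fun P hP => by
    simpa [hF₁] using hP
  have m₂ : ∀ P ∈ F₂, P ∈ F ∧ y 1 P ≤ x 0 P ∧ x 1 P ≤ y 0 P := fun P hP => by
    obtain ⟨h, h'⟩ := mem_filter.1 hP
    exact ⟨h, (hside P h).resolve_left h'⟩
  obtain ⟨p, q, hx, hy⟩ := sum_eq_count F₁ _ _ s t fun P hP => hcard P (m₁ P hP).1
  obtain ⟨p', q', hx', hy'⟩ := sum_eq_count F₂ _ _ s t fun P hP => hcard P (m₂ P hP).1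
  simp only [sum_add_distrib] at hx hy hx' hy'
  exact sizes_obstruction hst hsize ((hF _).trans hx0) ((hF _).trans hx1) ((hF _).trans hx2)
    ((hF _).trans hy0) ((hF _).trans hy1) ((hF _).trans hy2) hx hy hx' hy'
    (sum_le_sum fun P hP => (m₁ P hP).2.1) (sum_le_sum fun P hP => (m₁ P hP).2.2)
    (sum_le_sum fun P hP => (m₂ P hP).2.1) (sum_le_sum fun P hP => (m₂ P hP).2.2)

/-! ### The obstruction in graphs -/

/-- A graph with a 2-colouring `β` and classes `ℓ`, in which class `0` is independent and the
edges between the classes `1` and `2` span a `K_{2,2}`-free graph of maximum degree less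
than `s`. -/
structure IsSparselyCrossing {α : Type*} (G : SimpleGraph α) (s : ℕ) (ℓ : α → Fin 3)
    (β : α → Bool) : Prop where
  bip : ∀ x y, G.Adj x y → β x ≠ β y
  indep : ∀ x y, G.Adj x y → ℓ x = 0 → ℓ y ≠ 0
  deg₁ : ∀ x, ℓ x = 1 → ∀ Y : Finset α, (∀ y ∈ Y, ℓ y = 2 ∧ G.Adj x y) → Y.card + 1 ≤ s
  deg₂ : ∀ x, ℓ x = 2 → ∀ Y : Finset α, (∀ y ∈ Y, ℓ y = 1 ∧ G.Adj x y) → Y.card + 1 ≤ s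
  K22free : ∀ x x' y y', ℓ x = 1 → ℓ x' = 1 → ℓ y = 2 → ℓ y' = 2 →
    β x = β x' → β y = β y' →
    G.Adj x y → G.Adj x y' → G.Adj x' y → G.Adj x' y' → x = x' ∨ y = y'

theorem card_eq_sum_classes {α : Type*} (ℓ : α → Fin 3) (X : Finset α) :
    X.card = (X.filter (ℓ · = 0)).card + (X.filter (ℓ · = 1)).card +
      (X.filter (ℓ · = 2)).card := by
  rw [card_eq_sum_card_fiberwise (f := ℓ) (t := univ) (by simp), Fin.sum_univ_three]

theorem IsSparselyCrossing.copy_side {α : Type*} [Fintype α] {G : SimpleGraph α} {s t c : ℕ}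
    {ℓ : α → Fin 3} {β : α → Bool} (hG : IsSparselyCrossing G s ℓ β) (hst : s < t)
    (hc : c = 0 ∨ (t = c + s + 2 ∧ c + 1 ≤ s))
    (h0 : ∀ d, (univ.filter fun v => ℓ v = 0 ∧ β v = d).card = c) {X Y : Finset α} {d d' : Bool}
    (hX : ∀ x ∈ X, β x = d) (hY : ∀ y ∈ Y, β y = d')
    (hcard : (X.card = s ∧ Y.card = t) ∨ (X.card = t ∧ Y.card = s))
    (hadj : ∀ x ∈ X, ∀ y ∈ Y, G.Adj x y) :
    ((Y.filter (ℓ · = 2)).card ≤ (X.filter (ℓ · = 0)).card ∧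
      (X.filter (ℓ · = 2)).card ≤ (Y.filter (ℓ · = 0)).card) ∨
    ((Y.filter (ℓ · = 1)).card ≤ (X.filter (ℓ · = 0)).card ∧
      (X.filter (ℓ · = 1)).card ≤ (Y.filter (ℓ · = 0)).card) := by
  have hle : ∀ {Z : Finset α} {d : Bool}, (∀ z ∈ Z, β z = d) →
      (Z.filter (ℓ · = 0)).card ≤ c := by
    intro Z d hZ
    rw [← h0 d]
    refine card_le_card fun z hz => ?_
    rw [mem_filter] at hz
    simp [hz.2, hZ z hz.1]
  have hdeg₁ : ∀ {Z W : Finset α}, (∀ z ∈ Z, ∀ w ∈ W, G.Adj z w) →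
      (Z.filter (ℓ · = 1)).card = 0 ∨ (W.filter (ℓ · = 2)).card + 1 ≤ s := by
    intro Z W h
    rcases (Z.filter (ℓ · = 1)).eq_empty_or_nonempty with hZ | ⟨z, hz⟩
    · exact .inl (by simp [hZ])
    · rw [mem_filter] at hz
      exact .inr (hG.deg₁ z hz.2 _ fun w hw => ⟨(mem_filter.1 hw).2,
        h z hz.1 w (mem_filter.1 hw).1⟩)
  have hdeg₂ : ∀ {Z W : Finset α}, (∀ z ∈ Z, ∀ w ∈ W, G.Adj z w) →
      (Z.filter (ℓ · = 2)).card = 0 ∨ (W.filter (ℓ · = 1)).card + 1 ≤ s := by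
    intro Z W h
    rcases (Z.filter (ℓ · = 2)).eq_empty_or_nonempty with hZ | ⟨z, hz⟩
    · exact .inl (by simp [hZ])
    · rw [mem_filter] at hz
      exact .inr (hG.deg₂ z hz.2 _ fun w hw => ⟨(mem_filter.1 hw).2,
        h z hz.1 w (mem_filter.1 hw).1⟩)
  have hK : ∀ {Z W : Finset α} {d d' : Bool}, (∀ z ∈ Z, β z = d) → (∀ w ∈ W, β w = d') →
      (∀ z ∈ Z, ∀ w ∈ W, G.Adj z w) →
      (Z.filter (ℓ · = 1)).card ≤ 1 ∨ (W.filter (ℓ · = 2)).card ≤ 1 := by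
    intro Z W d d' hZ hW h
    by_contra! hlt
    obtain ⟨z, hz, z', hz', hzz⟩ := one_lt_card.1 hlt.1
    obtain ⟨w, hw, w', hw', hww⟩ := one_lt_card.1 hlt.2
    rw [mem_filter] at hz hz' hw hw'
    rcases hG.K22free z z' w w' hz.2 hz'.2 hw.2 hw'.2 ((hZ z hz.1).trans (hZ z' hz'.1).symm)
      ((hW w hw.1).trans (hW w' hw'.1).symm) (h z hz.1 w hw.1) (h z hz.1 w' hw'.1)
      (h z' hz'.1 w hw.1) (h z' hz'.1 w' hw'.1) with h | h
    · exact hzz h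
    · exact hww h
  have hadj' : ∀ y ∈ Y, ∀ x ∈ X, G.Adj y x := fun y hy x hx => (hadj x hx y hy).symm
  rw [card_eq_sum_classes ℓ X, card_eq_sum_classes ℓ Y] at hcard
  refine PaperTiling.copy_side hst hc hcard (hle hX) (hle hY) ?_ (hdeg₁ hadj) (hdeg₂ hadj)
    (hdeg₁ hadj') (hdeg₂ hadj') (hK hX hY hadj) (hK hY hX hadj').symm
  by_contra! h
  obtain ⟨x, hx⟩ := card_ne_zero.1 h.1
  obtain ⟨y, hy⟩ := card_ne_zero.1 h.2
  rw [mem_filter] at hx hy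
  exact hG.indep x y (hadj x hx.1 y hy.1) hx.2 hy.2

/-- A bicoloured copy of `K_{s,t}` splits into its two colour classes. -/
theorem IsKst.exists_colour_split {α : Type*} [DecidableEq α] {G : SimpleGraph α}
    {s t : ℕ} {β : α → Bool}
    (hβ : ∀ x y, G.Adj x y → β x ≠ β y) (hs : 1 ≤ s) (hst : s < t) {S T : Finset α}
    (h : IsKst G s t S T) :
    ∃ X Y : Finset α, X = (S ∪ T).filter (β · = true) ∧ Y = (S ∪ T).filter (β · = false) ∧
      ((X.card = s ∧ Y.card = t) ∨ (X.card = t ∧ Y.card = s)) ∧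
      ∀ x ∈ X, ∀ y ∈ Y, G.Adj x y := by
  obtain ⟨-, hS, hT, hadj⟩ := h
  obtain ⟨u, hu⟩ : S.Nonempty := card_pos.1 (by omega)
  obtain ⟨v, hv⟩ : T.Nonempty := card_pos.1 (by omega)
  have hST : ∀ x ∈ S, ∀ y ∈ T, β y = !β x := fun x hx y hy => by
    have := hβ x y (hadj x hx y hy)
    revert this
    cases β x <;> cases β y <;> simp
  have hT' : ∀ y ∈ T, β y = !β u := hST u hu
  have hS' : ∀ x ∈ S, β x = β u := fun x hx => by
    have h1 := hST x hx v hv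
    have h2 := hST u hu v hv
    rw [h1] at h2
    exact Bool.not_inj h2
  cases hb : β u <;> rw [hb] at hS' hT'
  · have hX : (S ∪ T).filter (β · = true) = T := by
      ext z
      simp only [mem_filter, mem_union]
      refine ⟨fun ⟨h, hz⟩ => h.resolve_left fun h => ?_, fun h => ⟨.inr h, hT' z h⟩⟩
      simp [hS' z h] at hz
    have hY : (S ∪ T).filter (β · = false) = S := by
      ext z
      simp only [mem_filter, mem_union]
      refine ⟨fun ⟨h, hz⟩ => h.resolve_right fun h => ?_, fun h => ⟨.inl h, hS' z h⟩⟩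
      simp [hT' z h] at hz
    exact ⟨T, S, hX.symm, hY.symm, .inr ⟨hT, hS⟩, fun x hx y hy => (hadj y hy x hx).symm⟩
  · have hX : (S ∪ T).filter (β · = true) = S := by
      ext z
      simp only [mem_filter, mem_union]
      refine ⟨fun ⟨h, hz⟩ => h.resolve_right fun h => ?_, fun h => ⟨.inl h, hS' z h⟩⟩
      simp [hT' z h] at hz
    have hY : (S ∪ T).filter (β · = false) = T := by
      ext z
      simp only [mem_filter, mem_union]
      refine ⟨fun ⟨h, hz⟩ => h.resolve_left fun h => ?_, fun h => ⟨.inr h, hT' z h⟩⟩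
      simp [hS' z h] at hz
    exact ⟨S, T, hX.symm, hY.symm, .inl ⟨hS, hT⟩, hadj⟩

theorem IsKstTiling.sum_card_filter {G : SimpleGraph V} {s t : ℕ}
    {𝒯 : Finset (Finset V × Finset V)} (h : IsKstTiling G s t 𝒯) (p : V → Prop)
    [DecidablePred p] :
    ∑ P ∈ 𝒯, ((P.1 ∪ P.2).filter p).card = (univ.filter p).card := by
  rw [← h.2.2, sup_eq_biUnion, filter_biUnion, card_biUnion]
  intro P hP Q hQ hPQ
  exact disjoint_filter_filter (h.2.1 hP hQ hPQ)

theorem IsSparselyCrossing.not_tileable {G : SimpleGraph V} {s t c a b : ℕ} {ℓ : V → Fin 3}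
    {β : V → Bool} (hG : IsSparselyCrossing G s ℓ β) (hs : 1 ≤ s) (hst : s < t)
    (hsize : ExtremalSizes s t c a b)
    (h0 : ∀ d, (univ.filter fun v => ℓ v = 0 ∧ β v = d).card = c)
    (h1 : ∀ d, (univ.filter fun v => ℓ v = 1 ∧ β v = d).card = a)
    (h2 : ∀ d, (univ.filter fun v => ℓ v = 2 ∧ β v = d).card = b) :
    ¬ KstTileable G s t := by
  rintro ⟨𝒯, h𝒯⟩
  have hc : c = 0 ∨ (t = c + s + 2 ∧ c + 1 ≤ s) := by
    rcases hsize with h | h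
    · exact .inl h.1
    · exact .inr ⟨h.1, h.2.1⟩
  let w (d : Bool) (i : Fin 3) (P : Finset V × Finset V) : ℕ :=
    (((P.1 ∪ P.2).filter (β · = d)).filter (ℓ · = i)).card
  have hw : ∀ d i, ∑ P ∈ 𝒯, w d i P = (univ.filter fun v => ℓ v = i ∧ β v = d).card := by
    intro d i
    rw [← h𝒯.sum_card_filter]
    refine sum_congr rfl fun P _ => ?_
    simp only [w, filter_filter, and_comm]
  refine no_weighted_tiling 𝒯 (w true) (w false) hst hsize ?_ ?_
    ((hw _ _).trans (h0 _)) ((hw _ _).trans (h1 _)) ((hw _ _).trans (h2 _))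
    ((hw _ _).trans (h0 _)) ((hw _ _).trans (h1 _)) ((hw _ _).trans (h2 _))
  · intro P hP
    obtain ⟨X, Y, rfl, rfl, hcard, -⟩ := (h𝒯.1 P hP).exists_colour_split hG.bip hs hst
    rwa [card_eq_sum_classes ℓ, card_eq_sum_classes ℓ ((P.1 ∪ P.2).filter (β · = false))]
      at hcard
  · intro P hP
    obtain ⟨X, Y, rfl, rfl, hcard, hadj⟩ := (h𝒯.1 P hP).exists_colour_split hG.bip hs hst
    exact hG.copy_side hst hc h0 (fun x hx => (mem_filter.1 hx).2)
      (fun x hx => (mem_filter.1 hx).2) hcard hadj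

/-! ### The construction -/

section Construction

variable {c a b : ℕ}

/-- The class of a vertex label. -/
def labelClass : Fin c ⊕ Fin a ⊕ Fin b → Fin 3
  | .inl _ => 0
  | .inr (.inl _) => 1
  | .inr (.inr _) => 2

/-- The symmetric relation on labels whose bipartite double cover is the extremal graph. -/
def labelRel (R : Fin a → Fin b → Prop) :
    Fin c ⊕ Fin a ⊕ Fin b → Fin c ⊕ Fin a ⊕ Fin b → Prop
  | .inl _, .inl _ => False
  | .inl _, .inr _ => True
  | .inr _, .inl _ => True
  | .inr (.inl _), .inr (.inl _) => True
  | .inr (.inl i), .inr (.inr j) => R i j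
  | .inr (.inr j), .inr (.inl i) => R i j
  | .inr (.inr _), .inr (.inr _) => True

theorem labelRel_symm (R : Fin a → Fin b → Prop) (p q : Fin c ⊕ Fin a ⊕ Fin b) :
    labelRel R p q → labelRel R q p := by
  rcases p with p | p | p <;> rcases q with q | q | q <;> exact id

/-- The bipartite double cover of `labelRel R`, on a vertex set labelled by `f`. -/
def coverGraph {α : Type*} (R : Fin a → Fin b → Prop) (f : α ≃ (Fin c ⊕ Fin a ⊕ Fin b) × Bool) :
    SimpleGraph α where
  Adj x y := (f x).2 ≠ (f y).2 ∧ labelRel R (f x).1 (f y).1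
  symm := ⟨fun _ _ h => ⟨h.1.symm, labelRel_symm R _ _ h.2⟩⟩
  loopless := ⟨fun _ h => h.1 rfl⟩

theorem card_filter_label {α : Type*} [Fintype α] (f : α ≃ (Fin c ⊕ Fin a ⊕ Fin b) × Bool)
    (d : Bool) (p : Fin c ⊕ Fin a ⊕ Fin b → Prop) [DecidablePred p] :
    (univ.filter fun v => p (f v).1 ∧ (f v).2 = d).card = (univ.filter p).card := by
  refine card_bij (fun v _ => (f v).1) (fun v hv => by simpa using (mem_filter.1 hv).2.1) ?_
    fun q hq => ⟨f.symm (q, d), ?_, by simp⟩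
  · intro v hv w hw h
    simp only [mem_filter, mem_univ, true_and] at hv hw
    exact f.injective (Prod.ext h (hv.2.trans hw.2.symm))
  · simpa using hq

theorem degS_coverGraph {α : Type*} [Fintype α] (R : Fin a → Fin b → Prop)
    (f : α ≃ (Fin c ⊕ Fin a ⊕ Fin b) × Bool) (v : α) :
    degS (coverGraph R f) v univ = (univ.filter (labelRel R (f v).1)).card := by
  rw [degS, ← card_filter_label f (!(f v).2)]
  congr 1
  ext w
  have hne : ∀ d d' : Bool, d ≠ d' ↔ d' = !d := by decide
  simp only [mem_filter, mem_univ, true_and]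
  rw [and_comm, ← hne]
  rfl

theorem card_filter_sum (p : Fin c ⊕ Fin a ⊕ Fin b → Prop) (p₀ : Fin c → Prop)
    (p₁ : Fin a → Prop) (p₂ : Fin b → Prop) [DecidablePred p] [DecidablePred p₀]
    [DecidablePred p₁] [DecidablePred p₂] (h₀ : ∀ i, p (.inl i) ↔ p₀ i)
    (h₁ : ∀ i, p (.inr (.inl i)) ↔ p₁ i) (h₂ : ∀ i, p (.inr (.inr i)) ↔ p₂ i) :
    (univ.filter p).card = (univ.filter p₀).card + (univ.filter p₁).card +
      (univ.filter p₂).card := by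
  simp only [card_filter, Fintype.sum_sum_type, h₀, h₁, h₂, add_assoc]

theorem isSparselyCrossing_coverGraph {α : Type*} {s : ℕ} {R : Fin a → Fin b → Prop}
    (f : α ≃ (Fin c ⊕ Fin a ⊕ Fin b) × Bool)
    (hR₁ : ∀ i, (univ.filter fun j => R i j).card + 1 ≤ s)
    (hR₂ : ∀ j, (univ.filter fun i => R i j).card + 1 ≤ s)
    (hR : ∀ i i' j j', R i j → R i j' → R i' j → R i' j' → i = i' ∨ j = j') :
    IsSparselyCrossing (coverGraph R f) s (fun v => labelClass (f v).1) (fun v => (f v).2) := by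
  have h₁ : ∀ p : Fin c ⊕ Fin a ⊕ Fin b, labelClass p = 1 → ∃ i, p = .inr (.inl i) := by
    rintro (p | p | p) h <;> simp_all [labelClass]
  have h₂ : ∀ p : Fin c ⊕ Fin a ⊕ Fin b, labelClass p = 2 → ∃ i, p = .inr (.inr i) := by
    rintro (p | p | p) h <;> simp_all [labelClass]
  have hcol : ∀ {x y y' : α}, (coverGraph R f).Adj x y → (coverGraph R f).Adj x y' →
      (f y).1 = (f y').1 → y = y' := by
    intro x y y' h h' he
    have h1 := h.1
    have h2 := h'.1
    refine f.injective (Prod.ext he ?_)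
    revert h1 h2
    cases (f x).2 <;> cases (f y).2 <;> cases (f y').2 <;> simp
  refine ⟨fun x y h => h.1, ?_, ?_, ?_, ?_⟩
  · intro x y h hx hy
    have := h.2
    revert this hx hy
    rcases (f x).1 with p | p | p <;> rcases (f y).1 with q | q | q <;>
      simp [labelClass, labelRel]
  · intro x hx Y hY
    obtain ⟨i, hi⟩ := h₁ _ hx
    refine le_trans (Nat.succ_le_succ ?_) (hR₁ i)
    rw [← card_map (Function.Embedding.inr.trans Function.Embedding.inr :
      Fin b ↪ Fin c ⊕ Fin a ⊕ Fin b)]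
    refine card_le_card_of_injOn (fun y => (f y).1) ?_ fun y hy y' hy' h =>
      hcol (hY y hy).2 (hY y' hy').2 h
    intro y hy
    obtain ⟨j, hj⟩ := h₂ _ (hY y hy).1
    have := (hY y hy).2.2
    rw [hi, hj] at this
    simpa [hj, labelRel] using this
  · intro x hx Y hY
    obtain ⟨i, hi⟩ := h₂ _ hx
    refine le_trans (Nat.succ_le_succ ?_) (hR₂ i)
    rw [← card_map (Function.Embedding.inl.trans Function.Embedding.inr :
      Fin a ↪ Fin c ⊕ Fin a ⊕ Fin b)]
    refine card_le_card_of_injOn (fun y => (f y).1) ?_ fun y hy y' hy' h =>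
      hcol (hY y hy).2 (hY y' hy').2 h
    intro y hy
    obtain ⟨j, hj⟩ := h₁ _ (hY y hy).1
    have := (hY y hy).2.2
    rw [hi, hj] at this
    simpa [hj, labelRel] using this
  · intro x x' y y' hx hx' hy hy' hxx hyy a1 a2 a3 a4
    obtain ⟨i, hi⟩ := h₁ _ hx
    obtain ⟨i', hi'⟩ := h₁ _ hx'
    obtain ⟨j, hj⟩ := h₂ _ hy
    obtain ⟨j', hj'⟩ := h₂ _ hy'
    have b1 := a1.2
    have b2 := a2.2
    have b3 := a3.2
    have b4 := a4.2
    rw [hi, hj] at b1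
    rw [hi, hj'] at b2
    rw [hi', hj] at b3
    rw [hi', hj'] at b4
    rcases hR i i' j j' b1 b2 b3 b4 with rfl | rfl
    · exact .inl (f.injective (Prod.ext (hi.trans hi'.symm) hxx))
    · exact .inr (f.injective (Prod.ext (hj.trans hj'.symm) hyy))

end Construction

/-- Deleting vertices from one side of a regular `K_{2,2}`-free relation. -/
theorem exists_nearly_regular_K22free (d a e : ℕ) (hN : 2 ^ (d + 1) < a + e) :
    ∃ R : Fin a → Fin (a + e) → Prop,
      (∀ i, (univ.filter fun j => R i j).card = d) ∧
      (∀ j, (univ.filter fun i => R i j).card ≤ d) ∧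
      (∀ j, d ≤ (univ.filter fun i => R i j).card + e) ∧
      ∀ i i' j j', R i j → R i j' → R i' j → R i' j' → i = i' ∨ j = j' := by
  obtain ⟨R, h1, h2, h3⟩ := exists_regular_K22free d (a + e) hN
  have key : ∀ j, (univ.filter fun i : Fin a => R (Fin.castAdd e i) j).card +
      (univ.filter fun i : Fin e => R (Fin.natAdd a i) j).card = d := by
    intro j
    rw [← h2 j]
    simp only [card_filter, Fin.sum_univ_add]
  refine ⟨fun i j => R (Fin.castAdd e i) j, fun i => h1 _, fun j => ?_, fun j => ?_, ?_⟩
  · exact (key j) ▸ Nat.le_add_right _ _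
  · rw [← key j]
    gcongr
    exact (card_le_univ _).trans (by simp)
  · intro i i' j j' a1 a2 a3 a4
    exact (h3 _ _ j j' a1 a2 a3 a4).imp (fun h => Fin.castAdd_injective a e h) id

theorem exists_extremal_graph {s t c a e n : ℕ} (hs : 1 ≤ s) (hst : s < t)
    (hsize : ExtremalSizes s t c a (a + e)) (ha : 1 ≤ a) (hN : 2 ^ (s + 1) + c < a + e)
    (hn : n = c + a + (a + e)) :
    ∃ (G : SimpleGraph (Fin (2 * n))) (A B : Finset (Fin (2 * n))),
      IsBipartition G A B ∧ A.card = n ∧ B.card = n ∧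
      MinDegreeIs G ((c : ℝ) + a + s - 1) ∧ ¬ KstTileable G s t := by
  obtain ⟨d, rfl⟩ : ∃ d, s = d + 1 := ⟨s - 1, by omega⟩
  have hpow : 2 ^ (d + 1) < 2 ^ (d + 1 + 1) := Nat.pow_lt_pow_right (by norm_num) (by omega)
  have hd : d + 1 < 2 ^ (d + 1) := Nat.lt_two_pow_self
  obtain ⟨R, hR₁, hR₂, hR₂', hR⟩ := exists_nearly_regular_K22free d a e (by omega)
  let f : Fin (2 * n) ≃ (Fin c ⊕ Fin a ⊕ Fin (a + e)) × Bool :=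
    Fintype.equivOfCardEq (by simp; omega)
  have hside : ∀ d, (univ.filter fun v => (f v).2 = d).card = n := by
    intro d
    have := card_filter_label f d fun _ => True
    simp only [true_and] at this
    rw [this]
    simp
    omega
  have hdeg : ∀ v, d + c + a ≤ degS (coverGraph R f) v univ := by
    intro v
    rw [degS_coverGraph]
    rcases (f v).1 with i | i | i
    · rw [card_filter_sum _ (fun _ => False) (fun _ => True) (fun _ => True)
        (fun _ => Iff.rfl) (fun _ => Iff.rfl) fun _ => Iff.rfl]
      simp
      omega
    · rw [card_filter_sum _ (fun _ => True) (fun _ => True) (fun j => R i j)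
        (fun _ => Iff.rfl) (fun _ => Iff.rfl) fun _ => Iff.rfl]
      simp [hR₁]
      omega
    · have := hR₂' i
      rw [card_filter_sum _ (fun _ => True) (fun j => R j i) (fun _ => True)
        (fun _ => Iff.rfl) (fun _ => Iff.rfl) fun _ => Iff.rfl]
      simp
      omega
  refine ⟨coverGraph R f, univ.filter fun v => (f v).2 = true,
    univ.filter fun v => (f v).2 = false, ⟨?_, ?_, ?_⟩, hside _, hside _, ⟨?_, ?_⟩, ?_⟩
  · exact disjoint_filter.2 fun v _ h => by simp [h]
  · ext v
    simp
  · intro u v h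
    have := h.1
    revert this
    simp only [mem_filter, mem_univ, true_and]
    cases (f u).2 <;> cases (f v).2 <;> simp
  · intro v
    have : ((d + c + a : ℕ) : ℝ) ≤ degS (coverGraph R f) v univ := by exact_mod_cast hdeg v
    push_cast at this ⊢
    linarith
  · refine ⟨f.symm (.inr (.inl ⟨0, ha⟩), true), ?_⟩
    rw [degS_coverGraph, f.apply_symm_apply, card_filter_sum _ (fun _ => True) (fun _ => True)
      (fun j => R ⟨0, ha⟩ j) (fun _ => Iff.rfl) (fun _ => Iff.rfl) fun _ => Iff.rfl]
    simp [hR₁]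
    ring
  · refine (isSparselyCrossing_coverGraph f (fun i => by rw [hR₁])
      (fun j => Nat.succ_le_succ (hR₂ j)) hR).not_tileable (c := c) (a := a) (b := a + e)
      hs hst hsize (fun d => ?_) (fun d => ?_) fun d => ?_
    · rw [card_filter_label f d fun p => labelClass p = 0, card_filter_sum _ (fun _ => True)
        (fun _ => False) (fun _ => False) (by simp [labelClass]) (by simp [labelClass])
        (by simp [labelClass])]
      simp
    · rw [card_filter_label f d fun p => labelClass p = 1, card_filter_sum _ (fun _ => False)
        (fun _ => True) (fun _ => False) (by simp [labelClass]) (by simp [labelClass])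
        (by simp [labelClass])]
      simp
    · rw [card_filter_label f d fun p => labelClass p = 2, card_filter_sum _ (fun _ => False)
        (fun _ => False) (fun _ => True) (by simp [labelClass]) (by simp [labelClass])
        (by simp [labelClass])]
      simp

/-- Hladký–Schacht, lower bound: extremal balanced bipartite
graphs on `2n = 2m(s+t)` vertices with the stated minimum degree that cannot
be tiled with `K_{s,t}` (for `m` even, and for `m` odd with `t ≤ 2s+1`). -/
theorem hladky_schacht_lower_bound (s t : ℕ) (hs : 1 ≤ s) (hst : s < t) :
    ∃ m₀ : ℕ, ∀ m : ℕ, m₀ ≤ m → ∀ n : ℕ, n = m * (s + t) →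
      (Even m →
        ∃ (G : SimpleGraph (Fin (2 * n))) (A B : Finset (Fin (2 * n))),
          IsBipartition G A B ∧ A.card = n ∧ B.card = n ∧
          MinDegreeIs G ((n : ℝ) / 2 + s - 2) ∧
          ¬ KstTileable G s t) ∧
      (Odd m → t ≤ 2 * s + 1 →
        ∃ (G : SimpleGraph (Fin (2 * n))) (A B : Finset (Fin (2 * n))),
          IsBipartition G A B ∧ A.card = n ∧ B.card = n ∧
          MinDegreeIs G (((n : ℝ) + t + s) / 2 - 2) ∧
          ¬ KstTileable G s t) := by
  refine ⟨2 ^ (s + 3) + 4 * t, fun m hm n hn => ⟨?_, ?_⟩⟩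
  · rintro ⟨k, rfl⟩
    have hk : k ≤ k * (s + t) := Nat.le_mul_of_pos_right k (by omega)
    have hp : 2 ^ (s + 3) = 4 * 2 ^ (s + 1) := by ring
    have hn' : n = 2 * (k * (s + t)) := by rw [hn]; ring
    obtain ⟨a, ha⟩ : ∃ a, k * (s + t) = a + 1 := ⟨k * (s + t) - 1, by omega⟩
    have hdvd : ¬ (s + t) ∣ 2 * a := fun hdvd => by
      have h2 : (s + t) ∣ 2 * a + 2 := by
        rw [show 2 * a + 2 = 2 * k * (s + t) by rw [mul_assoc, ha]; ring]
        exact Dvd.intro_left _ rfl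
      have := Nat.le_of_dvd two_pos ((Nat.dvd_add_right hdvd).1 h2)
      omega
    obtain ⟨G, A, B, hbip, hA, hB, hdeg, hG⟩ :=
      exists_extremal_graph (s := s) (t := t) (c := 0) (a := a) (e := 2) (n := n) hs hst
        (.inl ⟨rfl, hdvd⟩) (by omega) (by omega) (by omega)
    refine ⟨G, A, B, hbip, hA, hB, ?_, hG⟩
    convert hdeg using 1
    rw [show n = 2 * (a + 1) by omega]
    push_cast
    ring
  · rintro ⟨k, rfl⟩ ht
    have hk : k ≤ k * (s + t) := Nat.le_mul_of_pos_right k (by omega)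
    have hp : 2 ^ (s + 3) = 4 * 2 ^ (s + 1) := by ring
    have hn' : n = 2 * (k * (s + t)) + (s + t) := by rw [hn]; ring
    have hnr : (n : ℝ) = 2 * (k * (s + t)) + (s + t) := by rw [hn']; push_cast; ring
    rcases Nat.lt_or_ge t (s + 2) with hts | hts
    · obtain rfl : t = s + 1 := by omega
      have hdvd : ¬ (s + (s + 1)) ∣ 2 * (k * (s + (s + 1)) + s) := fun hdvd => by
        have h2 : (s + (s + 1)) ∣ 2 * (k * (s + (s + 1)) + s) + 1 := ⟨2 * k + 1, by ring⟩
        have := Nat.le_of_dvd one_pos ((Nat.dvd_add_right hdvd).1 h2)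
        omega
      obtain ⟨G, A, B, hbip, hA, hB, hdeg, hG⟩ :=
        exists_extremal_graph (s := s) (t := s + 1) (c := 0) (a := k * (s + (s + 1)) + s)
          (e := 1) (n := n) hs hst (.inl ⟨rfl, hdvd⟩) (by omega) (by omega) (by omega)
      refine ⟨G, A, B, hbip, hA, hB, ?_, hG⟩
      convert hdeg using 1
      rw [hnr]
      push_cast
      ring
    · obtain ⟨c, rfl⟩ : ∃ c, t = c + s + 2 := ⟨t - s - 2, by omega⟩
      obtain ⟨G, A, B, hbip, hA, hB, hdeg, hG⟩ :=
        exists_extremal_graph (s := s) (t := c + s + 2) (c := c)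
          (a := k * (s + (c + s + 2)) + s + 1) (e := 0) (n := n) hs hst
          (.inr ⟨rfl, by omega, rfl, k, rfl⟩) (by omega) (by omega) (by omega)
      refine ⟨G, A, B, hbip, hA, hB, ?_, hG⟩
      convert hdeg using 1
      rw [hnr]
      push_cast
      ring

end PaperTiling
end

section
/- Let 1 ≤ s < t be fixed integers with t ≥ 2s+1. There exists m₀ such that for all odd m with m ≥ m₀ there exists a balanced bipartite graph G on 2n = 2m(s+t) vertices with δ(G) = (n+3s)/2 − 3/2 if t is odd, and δ(G) = (n+3s)/2 − 2 if t is even, such that G cannot be tiled with K_{s,t}. -/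
open scoped Classical
open Finset

namespace PaperTiling

variable {V : Type*} [Fintype V] [DecidableEq V]

/-- The arithmetic of one copy of `K_{s,t}`, or of a sum of copies: `x₁, y₁, x₂, y₂` count the
copies of either orientation on either side, `αᵢ` and `βᵢ` are the numbers of vertices of `U₀`
and `V₀` used on side `i`, and `pᵢ`, `qᵢ` count the vertices of the other side used there. -/
structure TileBalance (s t u0 u1 u2 v0 v1 v2 x1 y1 x2 y2 α1 α2 β1 β2 p1 p2 q1 q2 : ℕ) :
    Prop where
  u0_eq : α1 + α2 = u0
  v0_eq : β1 + β2 = v0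
  u1_eq : s * x1 + t * y1 + p2 = u1 + α1 + p1
  v1_eq : t * x1 + s * y1 + q2 = v1 + β1 + q1
  u2_eq : s * x2 + t * y2 + p1 = u2 + α2 + p2
  v2_eq : t * x2 + s * y2 + q1 = v2 + β2 + q2
  p1_le : p1 ≤ β1
  p2_le : p2 ≤ β2
  q1_le : q1 ≤ α1
  q2_le : q2 ≤ α2

lemma exists_tileBalance {s t u0 u1 u2 v0 v1 v2 : ℕ} (hs : 1 ≤ s) (ht : 2 * s + 1 ≤ t)
    (hsum : (u0 + u1 + u2 = s ∧ v0 + v1 + v2 = t) ∨ (u0 + u1 + u2 = t ∧ v0 + v1 + v2 = s))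
    (hu0 : u0 ≤ s - 1) (hv0 : v0 ≤ s - 1) (h0 : u0 = 0 ∨ v0 = 0)
    (h12 : (u1 = 0 ∨ v2 ≤ s - 1) ∧ (v2 = 0 ∨ u1 ≤ s - 1) ∧ (u1 ≤ 1 ∨ v2 ≤ 1))
    (h21 : (u2 = 0 ∨ v1 ≤ s - 1) ∧ (v1 = 0 ∨ u2 ≤ s - 1) ∧ (u2 ≤ 1 ∨ v1 ≤ 1)) :
    ∃ x1 y1 x2 y2 α1 α2 β1 β2 p1 p2 q1 q2 : ℕ,
      TileBalance s t u0 u1 u2 v0 v1 v2 x1 y1 x2 y2 α1 α2 β1 β2 p1 p2 q1 q2 := by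
  rcases hsum with ⟨hu, hv⟩ | ⟨hu, hv⟩
  · have : (u2 = 0 ∧ v2 = 0) ∨ (u1 = 0 ∧ v1 = 0) ∨
        (v0 = 0 ∧ u2 = 0 ∧ v2 ≤ u0) ∨ (v0 = 0 ∧ u1 = 0 ∧ v1 ≤ u0) := by
      omega
    rcases this with h | h | h | h
    · exact ⟨1, 0, 0, 0, u0, 0, v0, 0, 0, 0, 0, 0, by constructor <;> omega⟩
    · exact ⟨0, 0, 1, 0, 0, u0, 0, v0, 0, 0, 0, 0, by constructor <;> omega⟩
    · exact ⟨1, 0, 0, 0, u0, 0, 0, 0, 0, 0, v2, 0, by constructor <;> omega⟩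
    · exact ⟨0, 0, 1, 0, 0, u0, 0, 0, 0, 0, 0, v1, by constructor <;> omega⟩
  · have : (u2 = 0 ∧ v2 = 0) ∨ (u1 = 0 ∧ v1 = 0) ∨
        (u0 = 0 ∧ v2 = 0 ∧ u2 ≤ v0) ∨ (u0 = 0 ∧ v1 = 0 ∧ u1 ≤ v0) := by
      omega
    rcases this with h | h | h | h
    · exact ⟨0, 1, 0, 0, u0, 0, v0, 0, 0, 0, 0, 0, by constructor <;> omega⟩
    · exact ⟨0, 0, 0, 1, 0, u0, 0, v0, 0, 0, 0, 0, by constructor <;> omega⟩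
    · exact ⟨0, 1, 0, 0, 0, 0, v0, 0, u2, 0, 0, 0, by constructor <;> omega⟩
    · exact ⟨0, 0, 0, 1, 0, 0, 0, v0, 0, u1, 0, 0, by constructor <;> omega⟩

lemma TileBalance.sum {ι : Type*} {s t : ℕ} (I : Finset ι)
    {u0 u1 u2 v0 v1 v2 x1 y1 x2 y2 α1 α2 β1 β2 p1 p2 q1 q2 : ι → ℕ}
    (h : ∀ i ∈ I, TileBalance s t (u0 i) (u1 i) (u2 i) (v0 i) (v1 i) (v2 i) (x1 i) (y1 i)
      (x2 i) (y2 i) (α1 i) (α2 i) (β1 i) (β2 i) (p1 i) (p2 i) (q1 i) (q2 i)) :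
    TileBalance s t (∑ i ∈ I, u0 i) (∑ i ∈ I, u1 i) (∑ i ∈ I, u2 i) (∑ i ∈ I, v0 i)
      (∑ i ∈ I, v1 i) (∑ i ∈ I, v2 i) (∑ i ∈ I, x1 i) (∑ i ∈ I, y1 i) (∑ i ∈ I, x2 i)
      (∑ i ∈ I, y2 i) (∑ i ∈ I, α1 i) (∑ i ∈ I, α2 i) (∑ i ∈ I, β1 i) (∑ i ∈ I, β2 i)
      (∑ i ∈ I, p1 i) (∑ i ∈ I, p2 i) (∑ i ∈ I, q1 i) (∑ i ∈ I, q2 i) := by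
  constructor <;> try simp only [mul_sum, ← sum_add_distrib]
  · exact sum_congr rfl fun i hi => (h i hi).u0_eq
  · exact sum_congr rfl fun i hi => (h i hi).v0_eq
  · exact sum_congr rfl fun i hi => (h i hi).u1_eq
  · exact sum_congr rfl fun i hi => (h i hi).v1_eq
  · exact sum_congr rfl fun i hi => (h i hi).u2_eq
  · exact sum_congr rfl fun i hi => (h i hi).v2_eq
  · exact sum_le_sum fun i hi => (h i hi).p1_le
  · exact sum_le_sum fun i hi => (h i hi).p2_le
  · exact sum_le_sum fun i hi => (h i hi).q1_le
  · exact sum_le_sum fun i hi => (h i hi).q2_le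

lemma not_tileBalance {s t k x1 y1 x2 y2 α1 α2 β1 β2 p1 p2 q1 q2 : ℕ}
    (hs : 1 ≤ s) (ht : 2 * s + 1 ≤ t) :
    ¬ TileBalance s t (s - 1) (k * (s + t) + (t + 1) / 2) (k * (s + t) + (t + 2) / 2) (s - 1)
      (k * (s + t) + (t + 2) / 2) (k * (s + t) + (t + 1) / 2)
      x1 y1 x2 y2 α1 α2 β1 β2 p1 p2 q1 q2 := by
  rintro ⟨hα, hβ, hu1, hv1, hu2, hv2, hp1, hp2, hq1, hq2⟩
  have hfloor : (t + 1) / 2 + (t + 2) / 2 = t + 1 := by omega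
  have hdiff : (t + 2) / 2 = (t + 1) / 2 ∨ (t + 2) / 2 = (t + 1) / 2 + 1 := by omega
  generalize (t + 1) / 2 = f at *
  generalize (t + 2) / 2 = g at *
  obtain ⟨r, rfl⟩ : ∃ r, s = r + 1 := ⟨s - 1, by omega⟩
  simp only [Nat.add_sub_cancel] at hα hβ
  zify at *
  have side1 : ((r : ℤ) + 1 + t) * (x1 + y1 - 2 * k) =
      t + 1 + (α1 + p1 - p2) + (β1 + q1 - q2) := by linarith
  have side2 : ((r : ℤ) + 1 + t) * (x2 + y2 - 2 * k) =
      t + 1 + (α2 + p2 - p1) + (β2 + q2 - q1) := by linarith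
  have pos1 : (0 : ℤ) < x1 + y1 - 2 * k :=
    pos_of_mul_pos_right (a := (r : ℤ) + 1 + t) (by rw [side1]; omega) (by omega)
  have pos2 : (0 : ℤ) < x2 + y2 - 2 * k :=
    pos_of_mul_pos_right (a := (r : ℤ) + 1 + t) (by rw [side2]; omega) (by omega)
  have total : (x1 + y1 - 2 * k) + (x2 + y2 - 2 * k) = (2 : ℤ) := by
    apply mul_left_cancel₀ (show (r : ℤ) + 1 + t ≠ 0 by omega)
    linarith
  have one1 : (x1 : ℤ) + y1 - 2 * k = 1 := by omega
  rw [one1] at side1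
  have imbalance : ((t : ℤ) - (r + 1)) * (x1 - y1) =
      g - f + (β1 + q1 - q2) - (α1 + p1 - p2) := by linarith
  rcases lt_or_ge (0 : ℤ) (x1 - y1) with h | h
  · have : ((t : ℤ) - (r + 1)) * 1 ≤ ((t : ℤ) - (r + 1)) * (x1 - y1) :=
      mul_le_mul_of_nonneg_left h (by omega)
    omega
  · have : ((t : ℤ) - (r + 1)) * (x1 - y1) ≤ ((t : ℤ) - (r + 1)) * (-1) :=
      mul_le_mul_of_nonneg_left (by omega) (by omega)
    omega

lemma card_bounds_of_sparse {α : Type*} {G : SimpleGraph α} {P Q X Y : Finset α} {r : ℕ}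
    (hX : X ⊆ P) (hY : Y ⊆ Q) (hXY : Disjoint X Y) (hadj : ∀ u ∈ X, ∀ v ∈ Y, G.Adj u v)
    (hP : ∀ u ∈ P, degS G u Q ≤ r) (hQ : ∀ v ∈ Q, degS G v P ≤ r)
    (hfree : ∀ S T : Finset α, S ⊆ P → T ⊆ Q → ¬ IsKst G 2 2 S T) :
    (X.card = 0 ∨ Y.card ≤ r) ∧ (Y.card = 0 ∨ X.card ≤ r) ∧ (X.card ≤ 1 ∨ Y.card ≤ 1) := by
  refine ⟨?_, ?_, ?_⟩
  · rcases X.eq_empty_or_nonempty with rfl | ⟨x, hx⟩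
    · simp
    · exact .inr ((card_le_card fun y hy => mem_filter.2 ⟨hY hy, hadj x hx y hy⟩).trans
        (hP x (hX hx)))
  · rcases Y.eq_empty_or_nonempty with rfl | ⟨y, hy⟩
    · simp
    · exact .inr ((card_le_card fun x hx => mem_filter.2 ⟨hX hx, (hadj x hx y hy).symm⟩).trans
        (hQ y (hY hy)))
  · by_contra! h
    obtain ⟨S, hS, hS2⟩ := exists_subset_card_eq (show 2 ≤ X.card from h.1)
    obtain ⟨T, hT, hT2⟩ := exists_subset_card_eq (show 2 ≤ Y.card from h.2)
    exact hfree S T (hS.trans hX) (hT.trans hY)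
      ⟨hXY.mono hS hT, hS2, hT2, fun u hu v hv => hadj u (hS hu) v (hT hv)⟩

lemma IsBipartition.subset_of_isKst {G : SimpleGraph V} {A B S T : Finset V} {s t : ℕ}
    (hG : IsBipartition G A B) (hs : 1 ≤ s) (ht : 1 ≤ t) (h : IsKst G s t S T) :
    (S ⊆ A ∧ T ⊆ B) ∨ (S ⊆ B ∧ T ⊆ A) := by
  obtain ⟨hAB, -, hadj⟩ := hG
  obtain ⟨-, hS, hT, hST⟩ := h
  obtain ⟨x, hx⟩ : S.Nonempty := card_pos.1 (by omega)
  obtain ⟨y, hy⟩ : T.Nonempty := card_pos.1 (by omega)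
  have hd : ∀ z, z ∈ A → z ∉ B := fun z hz => disjoint_left.1 hAB hz
  rcases hadj x y (hST x hx y hy) with ⟨hxA, hyB⟩ | ⟨hxB, hyA⟩
  · refine .inl ⟨fun z hz => ?_, fun z hz => ?_⟩
    · rcases hadj z y (hST z hz y hy) with h | h
      exacts [h.1, absurd hyB (hd _ h.2)]
    · rcases hadj x z (hST x hx z hz) with h | h
      exacts [h.2, absurd h.1 (hd _ hxA)]
  · refine .inr ⟨fun z hz => ?_, fun z hz => ?_⟩
    · rcases hadj z y (hST z hz y hy) with h | h
      exacts [absurd h.2 (hd _ hyA), h.1]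
    · rcases hadj x z (hST x hx z hz) with h | h
      exacts [absurd hxB (hd _ h.1), h.2]

lemma StructH.exists_tileBalance {G : SimpleGraph V} {s t k : ℕ}
    {U0 U1 U2 V0 V1 V2 S T : Finset V} (h : StructH G s t k U0 U1 U2 V0 V1 V2)
    (hST : IsKst G s t S T) :
    ∃ x1 y1 x2 y2 α1 α2 β1 β2 p1 p2 q1 q2 : ℕ,
      TileBalance s t ((S ∪ T) ∩ U0).card ((S ∪ T) ∩ U1).card ((S ∪ T) ∩ U2).card
        ((S ∪ T) ∩ V0).card ((S ∪ T) ∩ V1).card ((S ∪ T) ∩ V2).card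
        x1 y1 x2 y2 α1 α2 β1 β2 p1 p2 q1 q2 := by
  have hs := h.hs
  have hside := h.bip.subset_of_isKst hs (by have := h.ht; omega) hST
  have hAB := disjoint_left.1 h.bip.1
  obtain ⟨-, hS, hT, hadj⟩ := hST
  have split : ∀ (W X Y Z : Finset V), Disjoint X Y → Disjoint X Z → Disjoint Y Z →
      (W ∩ (X ∪ Y ∪ Z)).card = (W ∩ X).card + (W ∩ Y).card + (W ∩ Z).card := by
    intro W X Y Z hXY hXZ hYZ
    rw [inter_union_distrib_left, inter_union_distrib_left, card_union_of_disjoint,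
      card_union_of_disjoint]
    · exact hXY.mono inter_subset_right inter_subset_right
    · rw [← inter_union_distrib_left]
      exact (disjoint_union_left.2 ⟨hXZ, hYZ⟩).mono inter_subset_right inter_subset_right
  have hU := split (S ∪ T) U0 U1 U2 h.hU01 h.hU02 h.hU12
  have hV := split (S ∪ T) V0 V1 V2 h.hV01 h.hV02 h.hV12
  have hcomp : ∀ u ∈ S ∪ T, ∀ v ∈ S ∪ T, u ∈ U0 ∪ U1 ∪ U2 → v ∈ V0 ∪ V1 ∪ V2 → G.Adj u v := by
    intro u hu v hv huA hvB
    rcases hside with ⟨h1, h2⟩ | ⟨h1, h2⟩ <;> rcases mem_union.1 hu with hu | hu <;>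
      rcases mem_union.1 hv with hv | hv
    exacts [absurd hvB (hAB (h1 hv)), hadj u hu v hv, absurd hvB (hAB (h1 hv)),
      absurd (h2 hu) (hAB huA), absurd (h1 hu) (hAB huA), absurd (h1 hu) (hAB huA),
      (hadj v hv u hu).symm, absurd hvB (hAB (h2 hv))]
  generalize hAe : U0 ∪ U1 ∪ U2 = A at *
  generalize hBe : V0 ∪ V1 ∪ V2 = B at *
  have hU0A : U0 ⊆ A := by rw [← hAe]; intro; simp +contextual
  have hU1A : U1 ⊆ A := by rw [← hAe]; intro; simp +contextual
  have hU2A : U2 ⊆ A := by rw [← hAe]; intro; simp +contextual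
  have hV0B : V0 ⊆ B := by rw [← hBe]; intro; simp +contextual
  have hV1B : V1 ⊆ B := by rw [← hBe]; intro; simp +contextual
  have hV2B : V2 ⊆ B := by rw [← hBe]; intro; simp +contextual
  have hinter : ∀ {C D : Finset V}, C ⊆ A → D ⊆ B →
      ∀ u ∈ (S ∪ T) ∩ C, ∀ v ∈ (S ∪ T) ∩ D, G.Adj u v := fun hC hD u hu v hv =>
    hcomp u (mem_inter.1 hu).1 v (mem_inter.1 hv).1 (hC (mem_inter.1 hu).2) (hD (mem_inter.1 hv).2)
  have hdisj : ∀ {C D : Finset V}, C ⊆ A → D ⊆ B →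
      Disjoint ((S ∪ T) ∩ C) ((S ∪ T) ∩ D) := fun hC hD =>
    disjoint_left.2 fun z hz hz' => hAB (hC (mem_inter.1 hz).2) (hD (mem_inter.1 hz').2)
  refine PaperTiling.exists_tileBalance hs h.ht ?_ ?_ ?_ ?_ ?_ ?_
  · rw [← hU, ← hV]
    rcases hside with ⟨h1, h2⟩ | ⟨h1, h2⟩
    · left
      have e1 : (S ∪ T) ∩ A = S := by grind
      have e2 : (S ∪ T) ∩ B = T := by grind
      rw [e1, e2]
      exact ⟨hS, hT⟩
    · right
      have e1 : (S ∪ T) ∩ A = T := by grind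
      have e2 : (S ∪ T) ∩ B = S := by grind
      rw [e1, e2]
      exact ⟨hT, hS⟩
  · exact (card_le_card inter_subset_right).trans h.cardU0.le
  · exact (card_le_card inter_subset_right).trans h.cardV0.le
  · simp only [card_eq_zero]
    by_contra! hne
    obtain ⟨⟨u, hu⟩, ⟨v, hv⟩⟩ := hne
    exact h.emptyU0V0 u (mem_inter.1 hu).2 v (mem_inter.1 hv).2
      (hinter hU0A hV0B u hu v hv)
  · exact card_bounds_of_sparse inter_subset_right inter_subset_right (hdisj hU1A hV2B)
      (hinter hU1A hV2B) h.degU1 h.degV2 h.K22freeU1V2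
  · exact card_bounds_of_sparse inter_subset_right inter_subset_right (hdisj hU2A hV1B)
      (hinter hU2A hV1B) h.degU2 h.degV1 h.K22freeU2V1

lemma IsKstTiling.sum_card_inter {G : SimpleGraph V} {s t : ℕ}
    {𝒯 : Finset (Finset V × Finset V)} (h : IsKstTiling G s t 𝒯) (X : Finset V) :
    ∑ P ∈ 𝒯, ((P.1 ∪ P.2) ∩ X).card = X.card := by
  obtain ⟨-, hdisj, hsup⟩ := h
  rw [sup_eq_biUnion] at hsup
  rw [← card_biUnion, ← biUnion_inter, hsup, univ_inter]
  exact fun P hP Q hQ hPQ =>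
    (hdisj hP hQ hPQ).mono inter_subset_left inter_subset_left

theorem StructH.not_kstTileable {G : SimpleGraph V} {s t k : ℕ}
    {U0 U1 U2 V0 V1 V2 : Finset V} (h : StructH G s t k U0 U1 U2 V0 V1 V2) :
    ¬ KstTileable G s t := by
  rintro ⟨𝒯, h𝒯⟩
  have key := fun P : 𝒯 => h.exists_tileBalance (h𝒯.1 P.1 P.2)
  choose x1 y1 x2 y2 α1 α2 β1 β2 p1 p2 q1 q2 key using key
  have hsum := TileBalance.sum 𝒯.attach fun P _ => key P
  have e := fun X => (𝒯.sum_attach fun P => ((P.1 ∪ P.2) ∩ X).card).trans (h𝒯.sum_card_inter X)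
  rw [e, e, e, e, e, e, h.cardU0, h.cardU1, h.cardU2, h.cardV0, h.cardV1, h.cardV2] at hsum
  exact not_tileBalance h.hs h.ht hsum

/-- Every solution of `a + d = b + c` in `D` is trivial. -/
def IsSidon {R : Type*} [Add R] (D : Finset R) : Prop :=
  ∀ a ∈ D, ∀ b ∈ D, ∀ c ∈ D, ∀ d ∈ D, a + d = b + c → a = b ∨ a = c

lemma three_pow_add_three_pow {p q r u : ℕ} (h : 3 ^ p + 3 ^ u = 3 ^ r + 3 ^ q) :
    p = r ∨ p = q := by
  have key : ∀ {x y : ℕ}, x < y → 3 * 3 ^ x ≤ 3 ^ y := fun {x y} hxy => by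
    rw [← pow_succ']
    exact Nat.pow_le_pow_right (by norm_num) hxy
  have pos : ∀ x : ℕ, 0 < 3 ^ x := fun x => by positivity
  have := pos p
  have := pos q
  have := pos r
  have := pos u
  by_contra! hne
  rcases lt_or_gt_of_ne hne.1 with h1 | h1 <;> rcases lt_or_gt_of_ne hne.2 with h2 | h2 <;>
    rcases lt_trichotomy u r with h3 | rfl | h3 <;>
    rcases lt_trichotomy u q with h4 | rfl | h4 <;>
    have k1 := key h1 <;> have k2 := key h2 <;> first
      | omega
      | (have k3 := key h3; omega)
      | (have k4 := key h4; omega)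
      | (have k3 := key h3; have k4 := key h4; omega)

lemma exists_isSidon (r a : ℕ) (ha : 2 * 3 ^ r < a) :
    ∃ D : Finset (ZMod a), D.card = r ∧ IsSidon D := by
  have hle : ∀ {i : ℕ}, i < r → 3 ^ i ≤ 3 ^ r := fun hi =>
    Nat.pow_le_pow_right (by norm_num) hi.le
  refine ⟨(range r).image fun i => ((3 ^ i : ℕ) : ZMod a), ?_, ?_⟩
  · rw [card_image_of_injOn, card_range]
    intro i hi j hj hij
    have := hle (mem_range.1 hi)
    have := hle (mem_range.1 hj)
    exact Nat.pow_right_injective (by norm_num : 2 ≤ 3)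
      (((ZMod.natCast_eq_natCast_iff _ _ _).1 hij).eq_of_lt_of_lt (by omega) (by omega))
  · simp only [IsSidon, forall_mem_image, mem_range]
    intro p hp q hq u hu v hv h
    have := hle hp
    have := hle hq
    have := hle hu
    have := hle hv
    rw [← Nat.cast_add, ← Nat.cast_add, ZMod.natCast_eq_natCast_iff] at h
    rcases three_pow_add_three_pow (h.eq_of_lt_of_lt (by omega) (by omega)) with rfl | rfl <;>
      simp

lemma card_filter_sub_mem {R : Type*} [AddCommGroup R] [Fintype R] (D : Finset R) (i : R)
    [DecidablePred fun j => j - i ∈ D] : (univ.filter fun j => j - i ∈ D).card = D.card := by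
  refine card_bij (fun j _ => j - i) (by simp) (fun j _ j' _ h => by simpa using h)
    fun d hd => ⟨d + i, by simpa using hd⟩

lemma card_filter_sub_mem' {R : Type*} [AddCommGroup R] [Fintype R] (D : Finset R) (j : R)
    [DecidablePred fun i => j - i ∈ D] : (univ.filter fun i => j - i ∈ D).card = D.card := by
  refine card_bij (fun i _ => j - i) (by simp) (fun j _ j' _ h => by simpa using h)
    fun d hd => ⟨j - d, by simpa using hd⟩

lemma IsSidon.eq_or_eq {R : Type*} [AddCommGroup R] {D : Finset R} (hD : IsSidon D)
    {i i' j j' : R} (h : j - i ∈ D) (h1 : j - i' ∈ D) (h2 : j' - i ∈ D) (h3 : j' - i' ∈ D) :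
    i = i' ∨ j = j' := by
  rcases hD _ h _ h1 _ h2 _ h3 (by abel) with e | e
  · exact .inl (by simpa using e)
  · exact .inr (by simpa using e)

/-- The bipartite graph on `α ⊕ β` with edges prescribed by the relation `R`. -/
def bipartiteGraph {α β : Type*} (R : α → β → Prop) : SimpleGraph (α ⊕ β) where
  Adj
    | .inl x, .inr y => R x y
    | .inr y, .inl x => R x y
    | _, _ => False
  symm := ⟨by rintro (x | x) (y | y) h <;> exact h⟩
  loopless := ⟨by rintro (x | x) h <;> exact h⟩

section

variable {α β : Type*} {R : α → β → Prop}

@[simp] lemma bipartiteGraph_inl_inl {x y : α} : ¬ (bipartiteGraph R).Adj (.inl x) (.inl y) := id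

@[simp] lemma bipartiteGraph_inr_inr {x y : β} : ¬ (bipartiteGraph R).Adj (.inr x) (.inr y) := id

@[simp] lemma bipartiteGraph_inl_inr {x : α} {y : β} :
    (bipartiteGraph R).Adj (.inl x) (.inr y) ↔ R x y := ⟨id, id⟩

@[simp] lemma bipartiteGraph_inr_inl {x : α} {y : β} :
    (bipartiteGraph R).Adj (.inr y) (.inl x) ↔ R x y := ⟨id, id⟩

end

/-- The edges of the extremal graph between `U₀ ∪ U₁ ∪ U₂` and `V₀ ∪ V₁ ∪ V₂`. -/
def extremalRel {ι A B : Type*} [Sub A] [Sub B] (D : Finset A) (E : Finset B) :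
    ι ⊕ A ⊕ B → ι ⊕ B ⊕ A → Prop
  | .inl _, .inl _ => False
  | .inl _, .inr _ => True
  | .inr _, .inl _ => True
  | .inr (.inl _), .inr (.inl _) => True
  | .inr (.inl i), .inr (.inr j) => j - i ∈ D
  | .inr (.inr i), .inr (.inl j) => j - i ∈ E
  | .inr (.inr _), .inr (.inr _) => True

section

variable {ι A B : Type*} [Sub A] [Sub B] {D : Finset A} {E : Finset B}

@[simp] lemma extremalRel_inl_inl {x y : ι} : ¬ extremalRel D E (.inl x) (.inl y) := id

@[simp] lemma extremalRel_inl_inr {x : ι} {y : B ⊕ A} : extremalRel D E (.inl x) (.inr y) :=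
  trivial

@[simp] lemma extremalRel_inr_inl {x : A ⊕ B} {y : ι} : extremalRel D E (.inr x) (.inl y) := by
  rcases x with x | x <;> trivial

@[simp] lemma extremalRel_inr_inl_inr_inl {i : A} {j : B} :
    extremalRel (ι := ι) D E (.inr (.inl i)) (.inr (.inl j)) := trivial

@[simp] lemma extremalRel_inr_inl_inr_inr {i j : A} :
    extremalRel (ι := ι) D E (.inr (.inl i)) (.inr (.inr j)) ↔ j - i ∈ D := ⟨id, id⟩

@[simp] lemma extremalRel_inr_inr_inr_inl {i j : B} :
    extremalRel (ι := ι) D E (.inr (.inr i)) (.inr (.inl j)) ↔ j - i ∈ E := ⟨id, id⟩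

@[simp] lemma extremalRel_inr_inr_inr_inr {i : B} {j : A} :
    extremalRel (ι := ι) D E (.inr (.inr i)) (.inr (.inr j)) := trivial

end

open Function.Embedding in
lemma structH_extremal {s t k : ℕ} (hs : 1 ≤ s) (hst : s < t) (ht : 2 * s + 1 ≤ t) (hk : 1 ≤ k)
    {A B : Type*} [AddCommGroup A] [AddCommGroup B] [Fintype A] [Fintype B]
    [DecidableEq A] [DecidableEq B]
    (hA : Fintype.card A = k * (s + t) + (t + 1) / 2)
    (hB : Fintype.card B = k * (s + t) + (t + 2) / 2)
    {D : Finset A} {E : Finset B} (hD : IsSidon D) (hE : IsSidon E)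
    (hDs : D.card = s - 1) (hEs : E.card = s - 1) :
    StructH (bipartiteGraph (extremalRel (ι := Fin (s - 1)) D E)) s t k
      (univ.map (inl.trans inl)) (univ.map ((inl.trans inr).trans inl))
      (univ.map ((inr.trans inr).trans inl))
      (univ.map (inl.trans inr)) (univ.map ((inl.trans inr).trans inr))
      (univ.map ((inr.trans inr).trans inr)) where
  hs := hs
  hst := hst
  ht := ht
  hk := hk
  bip := by
    refine ⟨?_, ?_, ?_⟩
    · simp [disjoint_left]
    · ext x
      rcases x with (x | x | x) | (x | x | x) <;> simp
    · rintro (u | u) (v | v) h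
      · exact h.elim
      · left
        rcases u with u | u | u <;> rcases v with v | v | v <;> simp
      · right
        rcases u with u | u | u <;> rcases v with v | v | v <;> simp
      · exact h.elim
  hU01 := by simp [disjoint_left]
  hU02 := by simp [disjoint_left]
  hU12 := by simp [disjoint_left]
  hV01 := by simp [disjoint_left]
  hV02 := by simp [disjoint_left]
  hV12 := by simp [disjoint_left]
  cardU0 := by simp
  cardV0 := by simp
  cardU1 := by simp [hA]
  cardV2 := by simp [hA]
  cardV1 := by simp [hB]
  cardU2 := by simp [hB]
  compU1V1 := by simp
  compU2V2 := by simp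
  compU0 := by simp [or_imp, forall_and]
  compV0 := by simp [or_imp, forall_and]
  emptyU0V0 := by simp
  K22freeU1V2 := by
    rintro S T hS hT ⟨-, hS2, hT2, hadj⟩
    obtain ⟨x, y, hxy, rfl⟩ := card_eq_two.1 hS2
    obtain ⟨z, w, hzw, rfl⟩ := card_eq_two.1 hT2
    simp only [insert_subset_iff, singleton_subset_iff, mem_map, mem_univ, true_and] at hS hT
    obtain ⟨⟨i, rfl⟩, ⟨i', rfl⟩⟩ := hS
    obtain ⟨⟨j, rfl⟩, ⟨j', rfl⟩⟩ := hT
    simp at hadj hxy hzw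
    rcases hD.eq_or_eq hadj.1.1 hadj.2.1 hadj.1.2 hadj.2.2 with h | h
    exacts [hxy h, hzw h]
  K22freeU2V1 := by
    rintro S T hS hT ⟨-, hS2, hT2, hadj⟩
    obtain ⟨x, y, hxy, rfl⟩ := card_eq_two.1 hS2
    obtain ⟨z, w, hzw, rfl⟩ := card_eq_two.1 hT2
    simp only [insert_subset_iff, singleton_subset_iff, mem_map, mem_univ, true_and] at hS hT
    obtain ⟨⟨i, rfl⟩, ⟨i', rfl⟩⟩ := hS
    obtain ⟨⟨j, rfl⟩, ⟨j', rfl⟩⟩ := hT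
    simp at hadj hxy hzw
    rcases hE.eq_or_eq hadj.1.1 hadj.2.1 hadj.1.2 hadj.2.2 with h | h
    exacts [hxy h, hzw h]
  degU1 := by simp [degS, filter_map, card_filter_sub_mem, hDs]
  degU2 := by simp [degS, filter_map, card_filter_sub_mem, hEs]
  degV1 := by simp [degS, filter_map, card_filter_sub_mem', hEs]
  degV2 := by simp [degS, filter_map, card_filter_sub_mem', hDs]

lemma minDegreeIs_extremal {ι A B : Type*} [AddCommGroup A] [AddCommGroup B] [Fintype ι]
    [Fintype A] [Fintype B] {D : Finset A} {E : Finset B} (hι : Fintype.card ι = D.card)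
    (hDE : D.card = E.card) (hAB : Fintype.card A ≤ Fintype.card B)
    (hDB : 2 * D.card ≤ Fintype.card B) :
    MinDegreeIs (bipartiteGraph (extremalRel (ι := ι) D E))
      ((Fintype.card A + 2 * D.card : ℕ) : ℝ) := by
  have hdeg : ∀ v, degS (bipartiteGraph (extremalRel (ι := ι) D E)) v univ =
      match v with
      | .inl (.inl _) | .inr (.inl _) => Fintype.card A + Fintype.card B
      | .inl (.inr (.inl _)) | .inr (.inr (.inr _)) => Fintype.card B + 2 * D.card
      | .inl (.inr (.inr _)) | .inr (.inr (.inl _)) => Fintype.card A + 2 * D.card := by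
    rintro ((v | v | v) | (v | v | v)) <;>
      simp [degS, card_filter, Fintype.sum_sum_type, -sum_boole] <;>
      (try simp [card_filter_sub_mem, card_filter_sub_mem', hι, ← hDE]) <;>
      omega
  refine ⟨fun v => ?_, .inl (.inr (.inr 0)), by rw [hdeg]⟩
  rw [hdeg, Nat.cast_le]
  rcases v with (v | v | v) | (v | v | v) <;> dsimp only <;> omega

section Comap

variable {W : Type*} [Fintype W] [DecidableEq W] (e : V ≃ W) {G : SimpleGraph W}

lemma IsBipartition.comap {A B : Finset W} (h : IsBipartition G A B) :
    IsBipartition (G.comap e) (A.map e.symm.toEmbedding) (B.map e.symm.toEmbedding) := by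
  obtain ⟨hd, hu, hadj⟩ := h
  refine ⟨(disjoint_map _).2 hd, by rw [← map_union, hu, map_univ_equiv], fun u v huv => ?_⟩
  simpa [mem_map_equiv] using hadj _ _ huv

lemma MinDegreeIs.comap {V W : Type*} [Fintype V] [Fintype W] (e : V ≃ W) {G : SimpleGraph W}
    {c : ℝ} (h : MinDegreeIs G c) : MinDegreeIs (G.comap e) c := by
  have hdeg : ∀ v, degS (G.comap e) v univ = degS G (e v) univ := fun v =>
    card_bij (fun w _ => e w) (by simp) (by simp) fun w hw => ⟨e.symm w, by simpa using hw⟩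
  obtain ⟨hle, v, hv⟩ := h
  exact ⟨fun v => by rw [hdeg]; exact hle _, e.symm v, by simpa [hdeg] using hv⟩

lemma KstTileable.of_comap {s t : ℕ} (h : KstTileable (G.comap e) s t) : KstTileable G s t := by
  obtain ⟨𝒯, hK, hd, hu⟩ := h
  refine ⟨𝒯.image fun P => (P.1.map e.toEmbedding, P.2.map e.toEmbedding), ?_, ?_, ?_⟩
  · simp only [forall_mem_image]
    intro P hP
    obtain ⟨hdisj, hS, hT, hadj⟩ := hK P hP
    refine ⟨(disjoint_map _).2 hdisj, by simpa using hS, by simpa using hT, ?_⟩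
    simpa [-mem_map_equiv] using hadj
  · rw [coe_image]
    rintro _ ⟨P, hP, rfl⟩ _ ⟨Q, hQ, rfl⟩ hne
    simp only [Function.onFun, ← map_union, disjoint_map]
    exact hd hP hQ fun h => hne (by rw [h])
  · rw [sup_image, sup_eq_biUnion] at *
    ext w
    have := mem_biUnion.1 (hu ▸ mem_univ (e.symm w))
    simp only [mem_biUnion, Function.comp_apply, ← map_union, mem_map_equiv, mem_univ, iff_true]
    exact this

end Comap

/-- Tightness of the main theorem: for `1 ≤ s < t` with
`t ≥ 2s+1` and all sufficiently large odd `m`, there is a balanced bipartite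
graph on `2n = 2m(s+t)` vertices with `δ(G) = (n+3s)/2 − 3/2` (for `t` odd)
or `δ(G) = (n+3s)/2 − 2` (for `t` even) that cannot be tiled with `K_{s,t}`. -/
theorem main_lower_bound (s t : ℕ) (hs : 1 ≤ s) (hst : s < t) (ht : 2 * s + 1 ≤ t) :
    ∃ m₀ : ℕ, ∀ m : ℕ, m₀ ≤ m → Odd m → ∀ n : ℕ, n = m * (s + t) →
      ∃ (G : SimpleGraph (Fin (2 * n))) (A B : Finset (Fin (2 * n))),
        IsBipartition G A B ∧ A.card = n ∧ B.card = n ∧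
        (Odd t → MinDegreeIs G (((n : ℝ) + 3 * s) / 2 - 3 / 2)) ∧
        (Even t → MinDegreeIs G (((n : ℝ) + 3 * s) / 2 - 2)) ∧
        ¬ KstTileable G s t := by
  refine ⟨4 * 3 ^ s + 1, ?_⟩
  rintro m hm ⟨k, rfl⟩ n rfl
  have hk : 2 * 3 ^ s ≤ k := by omega
  have hkst : k ≤ k * (s + t) := Nat.le_mul_of_pos_right k (by omega)
  have hpow : 3 ^ (s - 1) ≤ 3 ^ s := Nat.pow_le_pow_right (by norm_num) (by omega)
  have hpos : 0 < 3 ^ s := by positivity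
  obtain ⟨a, ha⟩ : ∃ a, a = k * (s + t) + (t + 1) / 2 := ⟨_, rfl⟩
  obtain ⟨b, hb⟩ : ∃ b, b = k * (s + t) + (t + 2) / 2 := ⟨_, rfl⟩
  have : NeZero a := ⟨by omega⟩
  have : NeZero b := ⟨by omega⟩
  obtain ⟨D, hDs, hD⟩ := exists_isSidon (s - 1) a (by omega)
  obtain ⟨E, hEs, hE⟩ := exists_isSidon (s - 1) b (by omega)
  have hG := structH_extremal hs hst ht (by omega) ((ZMod.card a).trans ha)
    ((ZMod.card b).trans hb) hD hE hDs hEs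
  have hn : (2 * k + 1) * (s + t) = s - 1 + a + b := by
    have : (2 * k + 1) * (s + t) = 2 * (k * (s + t)) + (s + t) := by ring
    omega
  have hsb : s ≤ k * (s + t) := (Nat.le_add_right s t).trans (Nat.le_mul_of_pos_left _ (by omega))
  have hdeg := minDegreeIs_extremal (ι := Fin (s - 1)) (D := D) (E := E) (by simp [hDs])
    (hDs.trans hEs.symm) (by simp only [ZMod.card]; omega) (by simp only [ZMod.card]; omega)
  have hcard : Fintype.card (Fin (2 * ((2 * k + 1) * (s + t)))) =
      Fintype.card ((Fin (s - 1) ⊕ ZMod a ⊕ ZMod b) ⊕ (Fin (s - 1) ⊕ ZMod b ⊕ ZMod a)) := by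
    simp only [Fintype.card_sum, Fintype.card_fin, ZMod.card]
    omega
  let e := Fintype.equivOfCardEq hcard
  have hmin := hdeg.comap e
  rw [ZMod.card, hDs] at hmin
  refine ⟨_, _, _, hG.bip.comap e, ?_, ?_, fun ht' => ?_, fun ht' => ?_,
    fun h => hG.not_kstTileable (h.of_comap e)⟩
  · rw [card_map, card_union_of_disjoint, card_union_of_disjoint hG.hU01, hG.cardU0, hG.cardU1,
      hG.cardU2]
    · omega
    · exact disjoint_union_left.2 ⟨hG.hU02, hG.hU12⟩
  · rw [card_map, card_union_of_disjoint, card_union_of_disjoint hG.hV01, hG.cardV0, hG.cardV1,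
      hG.cardV2]
    · omega
    · exact disjoint_union_left.2 ⟨hG.hV02, hG.hV12⟩
  · convert hmin using 1
    obtain ⟨c, rfl⟩ := ht'
    obtain ⟨r, rfl⟩ : ∃ r, s = r + 1 := ⟨s - 1, by omega⟩
    rw [ha, show (2 * c + 1 + 1) / 2 = c + 1 by omega, Nat.add_sub_cancel]
    push_cast
    ring
  · convert hmin using 1
    obtain ⟨c, rfl⟩ := ht'
    obtain ⟨r, rfl⟩ : ∃ r, s = r + 1 := ⟨s - 1, by omega⟩
    rw [ha, show (c + c + 1) / 2 = c by omega, Nat.add_sub_cancel]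
    push_cast
    ring

end PaperTiling
end

section
/- For every α > 0 and every positive integer r there exist β > 0 and a positive integer m₁ such that the following holds for all n = mr with m ≥ m₁. Given a bipartite graph G[U,V] with |U| = |V| = n: if δ(G) ≥ (1/2 − β)n, then either G can be tiled with K_{r,r}, or there exist U₁′ ⊆ U and V₂′ ⊆ V with |U₁′| = |V₂′| = ⌊n/2⌋ and d(U₁′, V₂′) ≤ α. -/
open scoped Classical
open Finset

namespace PaperTiling

variable {V : Type*} [Fintype V] [DecidableEq V]

set_option linter.unusedSectionVars false

/-- The pair `(P, Q)` can be partitioned into copies of `K_{r,r}` with one side in `P` and the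
other one in `Q`. -/
inductive PairTileable (G : SimpleGraph V) (r : ℕ) : Finset V → Finset V → Prop
  | empty : PairTileable G r ∅ ∅
  | cons {P Q S T : Finset V} : PairTileable G r P Q → Disjoint P S → Disjoint Q T →
      S.card = r → T.card = r → (∀ u ∈ S, ∀ v ∈ T, G.Adj u v) →
      PairTileable G r (P ∪ S) (Q ∪ T)

/-- A family of pairwise disjoint balanced bicliques `(S i, T i)` with `S i ⊆ A` and
`T i ⊆ B`. -/
structure BicliqueFamily (G : SimpleGraph V) (A B : Finset V) {ι : Type}
    (S T : ι → Finset V) : Prop where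
  subL : ∀ i, S i ⊆ A
  subR : ∀ i, T i ⊆ B
  card_eq : ∀ i, (S i).card = (T i).card
  adj : ∀ i, ∀ u ∈ S i, ∀ v ∈ T i, G.Adj u v
  disjL : ∀ i j, i ≠ j → Disjoint (S i) (S j)
  disjR : ∀ i j, i ≠ j → Disjoint (T i) (T j)

section Tilings

variable {G : SimpleGraph V} {r : ℕ}

lemma PairTileable.symm {P Q : Finset V} (h : PairTileable G r P Q) : PairTileable G r Q P := by
  induction h with
  | empty => exact .empty
  | cons _ h1 h2 h3 h4 h5 ih =>
    exact ih.cons h2 h1 h4 h3 fun u hu v hv => (h5 v hv u hu).symm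

lemma PairTileable.union {P Q P' Q' : Finset V} (h : PairTileable G r P Q)
    (h' : PairTileable G r P' Q') (hP : Disjoint P P') (hQ : Disjoint Q Q') :
    PairTileable G r (P ∪ P') (Q ∪ Q') := by
  induction h' with
  | empty => simpa using h
  | cons _ h1 h2 h3 h4 h5 ih =>
    rw [disjoint_union_right] at hP hQ
    rw [← union_assoc, ← union_assoc]
    exact (ih hP.1 hQ.1).cons (disjoint_union_left.2 ⟨hP.2, h1⟩)
      (disjoint_union_left.2 ⟨hQ.2, h2⟩) h3 h4 h5

lemma PairTileable.biUnion {ι : Type} {S T : ι → Finset V} (F : Finset ι)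
    (h : ∀ i ∈ F, PairTileable G r (S i) (T i))
    (hS : ∀ i j, i ≠ j → Disjoint (S i) (S j)) (hT : ∀ i j, i ≠ j → Disjoint (T i) (T j)) :
    PairTileable G r (F.biUnion S) (F.biUnion T) := by
  induction F using Finset.induction_on with
  | empty => simpa using PairTileable.empty
  | insert a F ha ih =>
    rw [biUnion_insert, biUnion_insert]
    refine (h a (by simp)).union (ih fun i hi => h i (by simp [hi])) ?_ ?_ <;>
    · rw [disjoint_biUnion_right]
      intro i hi
      first
        | exact hS _ _ (by rintro rfl; exact ha hi)
        | exact hT _ _ (by rintro rfl; exact ha hi)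

lemma PairTileable.of_complete (k : ℕ) {S T : Finset V} (hS : S.card = r * k)
    (hT : T.card = r * k) (h : ∀ u ∈ S, ∀ v ∈ T, G.Adj u v) : PairTileable G r S T := by
  induction k generalizing S T with
  | zero =>
    obtain rfl : S = ∅ := by simpa using hS
    obtain rfl : T = ∅ := by simpa using hT
    exact .empty
  | succ k ih =>
    obtain ⟨S', hS', hSc⟩ := exists_subset_card_eq (s := S) (n := r) (by rw [hS]; nlinarith)
    obtain ⟨T', hT', hTc⟩ := exists_subset_card_eq (s := T) (n := r) (by rw [hT]; nlinarith)
    have e1 := card_sdiff_of_subset hS'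
    have e2 := card_sdiff_of_subset hT'
    have := (ih (S := S \ S') (T := T \ T') (by rw [e1, hS, hSc]; simp [mul_add])
      (by rw [e2, hT, hTc]; simp [mul_add]) fun u hu v hv =>
        h u (mem_sdiff.1 hu).1 v (mem_sdiff.1 hv).1).cons sdiff_disjoint sdiff_disjoint hSc hTc
        fun u hu v hv => h u (hS' hu) v (hT' hv)
    rwa [sdiff_union_of_subset hS', sdiff_union_of_subset hT'] at this

lemma degS_le_sdiff_add (v : V) (S T : Finset V) :
    degS G v S ≤ degS G v (S \ T) + T.card := by
  unfold degS
  calc _ ≤ ((S \ T).filter (fun w => G.Adj v w) ∪ T).card := by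
        refine card_le_card fun x hx => ?_
        simp only [mem_filter, mem_union, mem_sdiff] at hx ⊢
        tauto
    _ ≤ _ := card_union_le _ _

lemma PairTileable.of_core_left (hr : 1 ≤ r) (S T X : Finset V) (k : ℕ)
    (hSX : Disjoint S X) (hcS : S.card + X.card = r * k) (hcT : T.card = r * k)
    (h : ∀ u ∈ S, ∀ v ∈ T, G.Adj u v) (hX : ∀ x ∈ X, r * X.card ≤ degS G x T)
    (hS : r * X.card ≤ S.card) : PairTileable G r (S ∪ X) T := by
  induction X using Finset.induction_on generalizing S T k with
  | empty => simpa using PairTileable.of_complete k (by simpa using hcS) hcT h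
  | insert x X hx ih =>
    rw [card_insert_of_notMem hx] at *
    rw [disjoint_insert_right] at hSX
    obtain ⟨N, hN, hNc⟩ := exists_subset_card_eq (s := T.filter fun w => G.Adj x w) (n := r)
      (by have := hX x (by simp); unfold degS at this; nlinarith)
    obtain ⟨M, hM, hMc⟩ := exists_subset_card_eq (s := S) (n := r - 1) (by
      have : r * 1 ≤ r * (X.card + 1) := Nat.mul_le_mul_left _ (by omega)
      omega)
    have hNT : N ⊆ T := hN.trans (filter_subset _ _)
    obtain ⟨k, rfl⟩ : ∃ j, k = j + 1 := ⟨k - 1, by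
      rcases k with _ | k
      · simp at hcS
      · simp⟩
    have e1 := card_sdiff_of_subset hM
    have e2 := card_sdiff_of_subset hNT
    rw [mul_add, mul_one] at *
    have l1 := card_le_card hM
    have l2 := card_le_card hNT
    have key := ih (S := S \ M) (T := T \ N) (k := k)
      (hSX.2.mono_left sdiff_subset) (by omega) (by omega)
      (fun u hu v hv => h u (mem_sdiff.1 hu).1 v (mem_sdiff.1 hv).1)
      (fun y hy => by
        have h1 := hX y (mem_insert_of_mem hy)
        have h2 := degS_le_sdiff_add (G := G) y T N
        omega) (by omega)
    have := key.cons (S := insert x M) (T := N) (by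
        rw [disjoint_insert_right, disjoint_union_left, mem_union, mem_sdiff]
        exact ⟨by tauto, sdiff_disjoint, (hSX.2.mono_left hM).symm⟩) sdiff_disjoint
        (by rw [card_insert_of_notMem fun hxM => hSX.1 (hM hxM)]; omega) hNc
        (by
          intro u hu v hv
          rcases mem_insert.1 hu with rfl | hu
          · exact (mem_filter.1 (hN hv)).2
          · exact h u (hM hu) v (hNT hv))
    rw [sdiff_union_of_subset hNT] at this
    convert this using 1
    ext y
    have := @hM y
    simp only [mem_union, mem_insert, mem_sdiff]
    tauto

lemma PairTileable.of_core (hr : 1 ≤ r) (S T X Y : Finset V) (k : ℕ)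
    (hSX : Disjoint S X) (hTY : Disjoint T Y)
    (hcS : S.card + X.card = r * k) (hcT : T.card + Y.card = r * k)
    (h : ∀ u ∈ S, ∀ v ∈ T, G.Adj u v)
    (hX : ∀ x ∈ X, r * (X.card + Y.card) ≤ degS G x T)
    (hY : ∀ y ∈ Y, r * (X.card + Y.card) ≤ degS G y S)
    (hS : r * (X.card + Y.card) ≤ S.card) (hT : r * (X.card + Y.card) ≤ T.card) :
    PairTileable G r (S ∪ X) (T ∪ Y) := by
  induction Y using Finset.induction_on generalizing S T k with
  | empty => simpa using PairTileable.of_core_left hr S T X k hSX hcS (by simpa using hcT) h hX hS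
  | insert y Y hy ih =>
    rw [card_insert_of_notMem hy] at *
    rw [disjoint_insert_right] at hTY
    rw [← add_assoc, mul_add, mul_one] at *
    obtain ⟨N, hN, hNc⟩ := exists_subset_card_eq (s := S.filter fun w => G.Adj y w) (n := r)
      (by have := hY y (by simp); unfold degS at this; omega)
    obtain ⟨M, hM, hMc⟩ := exists_subset_card_eq (s := T) (n := r - 1) (by omega)
    have hNS : N ⊆ S := hN.trans (filter_subset _ _)
    obtain ⟨k, rfl⟩ : ∃ j, k = j + 1 := ⟨k - 1, by
      rcases k with _ | k
      · simp at hcT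
      · simp⟩
    have e1 := card_sdiff_of_subset hM
    have e2 := card_sdiff_of_subset hNS
    have l1 := card_le_card hM
    have l2 := card_le_card hNS
    have e3 := mul_add r X.card Y.card
    rw [mul_add r k, mul_one] at *
    have key := ih (S := S \ N) (T := T \ M) (k := k)
      (hSX.mono_left sdiff_subset) (hTY.2.mono_left sdiff_subset) (by omega) (by omega)
      (fun u hu v hv => h u (mem_sdiff.1 hu).1 v (mem_sdiff.1 hv).1)
      (fun x hx => by
        have h1 := hX x hx
        have h2 := degS_le_sdiff_add (G := G) x T M
        omega)
      (fun x hx => by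
        have h1 := hY x (mem_insert_of_mem hx)
        have h2 := degS_le_sdiff_add (G := G) x S N
        omega) (by omega) (by omega)
    have := key.cons (S := N) (T := insert y M) (by
        rw [disjoint_union_left]
        exact ⟨sdiff_disjoint, (hSX.mono_left hNS).symm⟩) (by
        rw [disjoint_insert_right, disjoint_union_left, mem_union, mem_sdiff]
        exact ⟨by tauto, sdiff_disjoint, (hTY.2.mono_left hM).symm⟩)
        hNc (by rw [card_insert_of_notMem fun hxM => hTY.1 (hM hxM)]; omega)
        (by
          intro u hu v hv
          rcases mem_insert.1 hv with rfl | hv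
          · exact ((mem_filter.1 (hN hu)).2).symm
          · exact h u (hNS hu) v (hM hv))
    convert this using 1
    · ext z
      have := @hNS z
      simp only [mem_union, mem_sdiff]
      tauto
    · ext z
      have := @hM z
      simp only [mem_union, mem_insert, mem_sdiff]
      tauto

lemma BicliqueFamily.symm {A B : Finset V} {ι : Type} {S T : ι → Finset V}
    (h : BicliqueFamily G A B S T) : BicliqueFamily G B A T S :=
  ⟨h.subR, h.subL, fun i => (h.card_eq i).symm, fun i u hu v hv => (h.adj i v hv u hu).symm,
    h.disjR, h.disjL⟩

lemma BicliqueFamily.add {A B : Finset V} {ι : Type} {S T : ι → Finset V}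
    (h : BicliqueFamily G A B S T) {X Y : Finset V} (hX : X ⊆ A) (hY : Y ⊆ B)
    (hc : X.card = Y.card) (hadj : ∀ u ∈ X, ∀ v ∈ Y, G.Adj u v)
    (hXS : ∀ i, Disjoint X (S i)) (hYT : ∀ i, Disjoint Y (T i)) :
    BicliqueFamily G A B (fun o : Option ι => o.elim X S) (fun o : Option ι => o.elim Y T) where
  subL := by rintro (_ | i); exacts [hX, h.subL i]
  subR := by rintro (_ | i); exacts [hY, h.subR i]
  card_eq := by rintro (_ | i); exacts [hc, h.card_eq i]
  adj := by rintro (_ | i); exacts [hadj, h.adj i]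
  disjL := by
    rintro (_ | i) (_ | j) hij
    exacts [absurd rfl hij, hXS j, (hXS i).symm, h.disjL i j fun e => hij (by rw [e])]
  disjR := by
    rintro (_ | i) (_ | j) hij
    exacts [absurd rfl hij, hYT j, (hYT i).symm, h.disjR i j fun e => hij (by rw [e])]

lemma PairTileable.exists_family {P Q : Finset V} (h : PairTileable G r P Q) :
    ∃ (ι : Type) (_ : Fintype ι) (S T : ι → Finset V), BicliqueFamily G P Q S T ∧
      (∀ i, (S i).card = r) ∧ univ.biUnion S = P ∧ univ.biUnion T = Q := by
  induction h with
  | empty =>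
    exact ⟨Empty, inferInstance, fun _ => ∅, fun _ => ∅, by constructor <;> simp, by simp,
      by simp, by simp⟩
  | @cons P Q X Y _ h1 h2 h3 h4 h5 ih =>
    obtain ⟨ι, _, S, T, hF, hc, hS, hT⟩ := ih
    have hF' : BicliqueFamily G (P ∪ X) (Q ∪ Y) S T :=
      { hF with
        subL := fun i => (hF.subL i).trans subset_union_left
        subR := fun i => (hF.subR i).trans subset_union_left }
    refine ⟨Option ι, inferInstance, fun o => o.elim X S, fun o => o.elim Y T,
      hF'.add subset_union_right subset_union_right (by rw [h3, h4]) h5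
        (fun i => (h1.mono_left (hF.subL i)).symm) (fun i => (h2.mono_left (hF.subR i)).symm),
      ?_, ?_, ?_⟩
    · rintro (_ | i); exacts [h3, hc i]
    · ext x; simp [← hS, or_comm, Option.exists]
    · ext x; simp [← hT, or_comm, Option.exists]

lemma PairTileable.kstTileable {A B : Finset V} (h : PairTileable G r A B)
    (hAB : Disjoint A B) (hU : A ∪ B = univ) : KstTileable G r r := by
  obtain ⟨ι, _, S, T, hF, hc, hS, hT⟩ := h.exists_family
  refine ⟨univ.image fun i => (S i, T i), ?_, ?_, ?_⟩
  · intro p hp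
    obtain ⟨i, -, rfl⟩ := mem_image.1 hp
    exact ⟨hAB.mono (hF.subL i) (hF.subR i), hc i, by rw [← hF.card_eq, hc], hF.adj i⟩
  · intro p hp q hq hpq
    simp only [coe_image, coe_univ, Set.image_univ, Set.mem_range] at hp hq
    obtain ⟨i, rfl⟩ := hp
    obtain ⟨j, rfl⟩ := hq
    have hij : i ≠ j := by rintro rfl; exact hpq rfl
    simp only [Function.onFun, disjoint_union_left, disjoint_union_right]
    exact ⟨⟨hF.disjL i j hij, (hAB.mono (hF.subL j) (hF.subR i)).symm⟩,
      hAB.mono (hF.subL i) (hF.subR j), hF.disjR i j hij⟩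
  · rw [← hU, ← hS, ← hT]
    ext x
    simp only [mem_sup, mem_image, mem_univ, true_and, mem_union, mem_biUnion]
    constructor
    · rintro ⟨p, ⟨i, rfl⟩, hx | hx⟩
      exacts [.inl ⟨i, hx⟩, .inr ⟨i, hx⟩]
    · rintro (⟨i, hx⟩ | ⟨i, hx⟩)
      exacts [⟨_, ⟨i, rfl⟩, .inl hx⟩, ⟨_, ⟨i, rfl⟩, .inr hx⟩]

end Tilings

section AlmostTiling

/-- A dense bipartite relation contains a complete bipartite one (Kővári–Sós–Turán). -/
lemma exists_complete_subrelation {δ : ℝ} (hδ : 0 < δ) (p q : ℕ) :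
    ∃ M N : ℕ, ∀ {ι κ : Type} (X : Finset ι) (Y : Finset κ) (R : ι → κ → Prop),
      M ≤ X.card → N ≤ Y.card → (∀ x ∈ X, δ * Y.card ≤ ((Y.filter (R x)).card : ℝ)) →
      ∃ X' ⊆ X, X'.card = p ∧ ∃ Y' ⊆ Y, Y'.card = q ∧ ∀ x ∈ X', ∀ y ∈ Y', R x y := by
  set M := p + ⌈2 * (p + 1) / δ⌉₊ with hM
  have hM1 : 2 * (p + 1) ≤ δ * M := by
    have := Nat.le_ceil (2 * ((p : ℝ) + 1) / δ)
    rw [div_le_iff₀ hδ] at this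
    rw [hM, Nat.cast_add]
    nlinarith [mul_nonneg hδ.le (Nat.cast_nonneg (α := ℝ) p)]
  have hM0 : (0 : ℝ) < M := by
    have : (0 : ℝ) < δ * M := lt_of_lt_of_le (by positivity) hM1
    exact pos_of_mul_pos_right this hδ.le
  refine ⟨M, ⌈2 * (2 ^ M * q) / δ⌉₊, fun {ι κ} X₀ Y R hX hY hR => ?_⟩
  have hY1 : 2 * (2 ^ M * q) ≤ δ * Y.card := by
    have := (Nat.le_ceil (2 * (2 ^ M * (q : ℝ)) / δ)).trans (Nat.cast_le.2 hY)
    rw [div_le_iff₀ hδ] at this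
    linarith
  obtain ⟨X, hXX, hXc⟩ := exists_subset_card_eq hX
  set D := Y.filter fun y => p ≤ (X.filter fun x => R x y).card with hD
  have hcount : δ * M * Y.card ≤ D.card * M + p * Y.card := by
    have h1 : ∑ x ∈ X, (Y.filter (R x)).card = ∑ y ∈ Y, (X.filter fun x => R x y).card :=
      sum_card_bipartiteAbove_eq_sum_card_bipartiteBelow R
    have h2 : ∑ y ∈ Y, (X.filter fun x => R x y).card ≤
        ∑ y ∈ Y, ((if y ∈ D then M else 0) + p) := by
      refine sum_le_sum fun y hy => ?_
      split_ifs with h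
      · exact ((card_filter_le _ _).trans_eq hXc).trans (by omega)
      · have : ¬ p ≤ (X.filter fun x => R x y).card := fun hp => h (mem_filter.2 ⟨hy, hp⟩)
        omega
    have h3 : ∑ y ∈ Y, ((if y ∈ D then M else 0) + p) = D.card * M + p * Y.card := by
      rw [sum_add_distrib, ← sum_filter, filter_mem_eq_inter,
        inter_eq_right.2 (filter_subset _ _)]
      simp [mul_comm, hD]
    have h4 : ∑ x ∈ X, δ * (Y.card : ℝ) ≤ ∑ x ∈ X, ((Y.filter (R x)).card : ℝ) :=
      sum_le_sum fun x hx => hR x (hXX hx)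
    rw [sum_const, nsmul_eq_mul, hXc] at h4
    have h5 : (∑ x ∈ X, ((Y.filter (R x)).card : ℝ)) ≤ D.card * M + p * Y.card := by
      exact_mod_cast (h1.le.trans h2).trans h3.le
    linarith
  have hDc : 2 ^ M * q ≤ D.card := by
    have : (2 ^ M * q : ℝ) * M ≤ D.card * M := by
      have h1 : (p : ℝ) * Y.card ≤ δ * M / 2 * Y.card := by gcongr; linarith
      nlinarith
    have := le_of_mul_le_mul_right this hM0
    exact_mod_cast this
  have hch : ∀ y ∈ D, ∃ Z ⊆ X.filter fun x => R x y, Z.card = p := fun y hy =>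
    exists_subset_card_eq (mem_filter.1 hy).2
  choose! c hc hcc using hch
  obtain ⟨Z, hZ, hZq⟩ := exists_le_card_fiber_of_mul_le_card_of_maps_to
    (s := D) (t := X.powersetCard p) (f := c) (n := q)
    (fun y hy => mem_powersetCard.2 ⟨(hc y hy).trans (filter_subset _ _), hcc y hy⟩)
    (powersetCard_nonempty.2 (by rw [hXc, hM]; exact Nat.le_add_right _ _))
    (by
      refine le_trans ?_ hDc
      gcongr
      rw [card_powersetCard, hXc]
      exact Nat.choose_le_two_pow M p)
  rw [mem_powersetCard] at hZ
  obtain ⟨Y', hY', hYc⟩ := exists_subset_card_eq hZq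
  refine ⟨Z, hZ.1.trans hXX, hZ.2, Y', hY'.trans ((filter_subset _ _).trans (filter_subset _ _)),
    hYc, fun x hx y hy => ?_⟩
  have h1 := mem_filter.1 (hY' hy)
  have h2 := hc y h1.1
  rw [h1.2] at h2
  exact (mem_filter.1 (h2 hx)).2

variable {W : Type} [Fintype W] [DecidableEq W] {G : SimpleGraph W} {A B : Finset W}

lemma BicliqueFamily.sum_card_le {ι : Type} [Fintype ι] {S T : ι → Finset W}
    (h : BicliqueFamily G A B S T) : ∑ i, (S i).card ≤ A.card := by
  rw [← card_biUnion fun i _ j _ hij => h.disjL i j hij]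
  exact card_le_card (biUnion_subset.2 fun i _ => h.subL i)

variable (G A B) in
lemma exists_maximal_family (H K : ℕ) :
    ∃ (ι : Type) (_ : Fintype ι) (S T : ι → Finset W), BicliqueFamily G A B S T ∧
      (∀ i, H < (S i).card ∧ (S i).card ≤ K) ∧
      ∀ (κ : Type) (_ : Fintype κ) (S' T' : κ → Finset W), BicliqueFamily G A B S' T' →
        (∀ i, (S' i).card ≤ K) → ∑ i, ((S' i).card - H) ≤ ∑ i, ((S i).card - H) := by
  set P : ℕ → Prop := fun v => ∃ (ι : Type) (_ : Fintype ι) (S T : ι → Finset W),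
    BicliqueFamily G A B S T ∧ (∀ i, (S i).card ≤ K) ∧ ∑ i, ((S i).card - H) = v with hP
  have h0 : P 0 :=
    ⟨Empty, inferInstance, fun _ => ∅, fun _ => ∅, by constructor <;> simp, by simp, by simp⟩
  have hb : ∀ v, P v → v ≤ A.card := by
    rintro v ⟨ι, _, S, T, hF, -, rfl⟩
    exact (sum_le_sum fun i _ => Nat.sub_le _ _).trans hF.sum_card_le
  obtain ⟨ι, _, S, T, hF, hK, hv⟩ := Nat.findGreatest_spec (P := P) (Nat.zero_le A.card) h0
  refine ⟨{i // H < (S i).card}, inferInstance, fun i => S i, fun i => T i, ?_,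
    fun i => ⟨i.2, hK i⟩, ?_⟩
  · exact ⟨fun i => hF.subL i, fun i => hF.subR i, fun i => hF.card_eq i, fun i => hF.adj i,
      fun i j hij => hF.disjL i j fun e => hij (Subtype.ext e),
      fun i j hij => hF.disjR i j fun e => hij (Subtype.ext e)⟩
  · intro κ _ S' T' hF' hK'
    have h0 : P (∑ i, ((S' i).card - H)) := ⟨κ, inferInstance, S', T', hF', hK', rfl⟩
    have h1 := Nat.le_findGreatest (hb _ h0) h0
    rw [← hv] at h1
    refine h1.trans (le_of_eq ?_)
    rw [← sum_subtype (univ.filter fun i => H < (S i).card) (by simp) fun i => (S i).card - H]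
    exact (sum_filter_of_ne fun i _ hi => by omega).symm

lemma BicliqueFamily.exchange {H : ℕ} (hH : 1 ≤ H) {ι : Type} [Fintype ι] {S T : ι → Finset W}
    (h : BicliqueFamily G A B S T) (hK : ∀ i, (S i).card ≤ 3 * H) (J : Finset ι)
    (hJ : J.card = 3 * H) (s t : ι → W) (hs : ∀ i ∈ J, s i ∈ S i) (ht : ∀ i ∈ J, t i ∈ T i)
    {X Y : Finset W} (hX : X ⊆ A) (hY : Y ⊆ B) (hXS : ∀ i, Disjoint X (S i))
    (hYT : ∀ i, Disjoint Y (T i)) (hXc : X.card = 3 * H) (hYc : Y.card = 3 * H)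
    (hsY : ∀ i ∈ J, ∀ y ∈ Y, G.Adj (s i) y) (htX : ∀ i ∈ J, ∀ x ∈ X, G.Adj (t i) x) :
    ∃ (κ : Type) (_ : Fintype κ) (S' T' : κ → Finset W), BicliqueFamily G A B S' T' ∧
      (∀ i, (S' i).card ≤ 3 * H) ∧ ∑ i, ((S i).card - H) < ∑ i, ((S' i).card - H) := by
  have inj : ∀ (S : ι → Finset W) (s : ι → W), (∀ i ∈ J, s i ∈ S i) →
      (∀ i j, i ≠ j → Disjoint (S i) (S j)) → (J.image s).card = 3 * H ∧
      ∀ i, (S i \ J.image s).card + (if i ∈ J then 1 else 0) = (S i).card := by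
    intro S s hs hd
    have uniq : ∀ i j, j ∈ J → s j ∈ S i → j = i := fun i j hj hji => by
      by_contra hne
      exact disjoint_left.1 (hd j i hne) (hs j hj) hji
    refine ⟨?_, fun i => ?_⟩
    · rw [card_image_of_injOn, hJ]
      exact fun i hi j hj hij => uniq j i hi (hij ▸ hs j hj)
    · have : J.image s ∩ S i = if i ∈ J then {s i} else ∅ := by
        ext x
        split_ifs with hi
        · simp only [mem_inter, mem_image, mem_singleton]
          constructor
          · rintro ⟨⟨j, hj, rfl⟩, hx⟩
            rw [uniq i j hj hx]
          · rintro rfl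
            exact ⟨⟨i, hi, rfl⟩, hs i hi⟩
        · simp only [mem_inter, mem_image, notMem_empty, iff_false]
          rintro ⟨⟨j, hj, rfl⟩, hx⟩
          exact hi (uniq i j hj hx ▸ hj)
      have h1 := card_sdiff_add_card_inter (S i) (J.image s)
      rw [inter_comm, this] at h1
      split_ifs at h1 ⊢ <;> simpa using h1
  obtain ⟨hE, hSE⟩ := inj S s hs h.disjL
  obtain ⟨hE', hTE⟩ := inj T t ht h.disjR
  have h1 : BicliqueFamily G A B (fun i => S i \ J.image s) (fun i => T i \ J.image t) :=
    ⟨fun i => sdiff_subset.trans (h.subL i), fun i => sdiff_subset.trans (h.subR i),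
      fun i => by have := hSE i; have := hTE i; have := h.card_eq i; omega,
      fun i u hu v hv => h.adj i u (mem_sdiff.1 hu).1 v (mem_sdiff.1 hv).1,
      fun i j hij => (h.disjL i j hij).mono sdiff_subset sdiff_subset,
      fun i j hij => (h.disjR i j hij).mono sdiff_subset sdiff_subset⟩
  have hEA : J.image s ⊆ A := image_subset_iff.2 fun i hi => h.subL i (hs i hi)
  have hEB : J.image t ⊆ B := image_subset_iff.2 fun i hi => h.subR i (ht i hi)
  have h2 := h1.add hEA hY (by rw [hE, hYc]) (by simpa using hsY) (fun i => disjoint_sdiff)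
    (fun i => (hYT i).mono_right sdiff_subset)
  have h3 := h2.add hX hEB (by rw [hE', hXc])
    (by simpa using fun x hx i hi => (htX i hi x hx).symm)
    (by
      rintro (_ | i)
      · exact disjoint_right.2 fun x hx => by
          obtain ⟨i, hi, rfl⟩ := mem_image.1 hx
          exact disjoint_right.1 (hXS i) (hs i hi)
      · exact (hXS i).mono_right sdiff_subset)
    (by
      rintro (_ | i)
      · exact disjoint_left.2 fun x hx => by
          obtain ⟨i, hi, rfl⟩ := mem_image.1 hx
          exact disjoint_right.1 (hYT i) (ht i hi)
      · exact disjoint_sdiff)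
  refine ⟨_, inferInstance, _, _, h3, ?_, ?_⟩
  · rintro (_ | _ | i)
    exacts [hXc.le, hE.le, (card_le_card sdiff_subset).trans (hK i)]
  · simp only [Fintype.sum_option, Option.elim, hXc, hE]
    have h4 : ∑ i, ((S i).card - H) ≤
        ∑ i, (((S i \ J.image s).card - H) + if i ∈ J then 1 else 0) :=
      sum_le_sum fun i _ => by have := hSE i; omega
    rw [sum_add_distrib, sum_boole] at h4
    simp [hJ] at h4
    omega

lemma BicliqueFamily.extend {H : ℕ} (hH : 1 ≤ H) {ι : Type} [Fintype ι] {S T : ι → Finset W}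
    (h : BicliqueFamily G A B S T) (hK : ∀ i, (S i).card ≤ 3 * H)
    {X Y : Finset W} (hX : X ⊆ A) (hY : Y ⊆ B) (hXS : ∀ i, Disjoint X (S i))
    (hYT : ∀ i, Disjoint Y (T i)) (hXc : X.card = 3 * H) (hYc : Y.card = 3 * H)
    (hXY : ∀ x ∈ X, ∀ y ∈ Y, G.Adj x y) :
    ∃ (κ : Type) (_ : Fintype κ) (S' T' : κ → Finset W), BicliqueFamily G A B S' T' ∧
      (∀ i, (S' i).card ≤ 3 * H) ∧ ∑ i, ((S i).card - H) < ∑ i, ((S' i).card - H) := by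
  refine ⟨_, inferInstance, _, _, h.add hX hY (hXc.trans hYc.symm) hXY hXS hYT, ?_, ?_⟩
  · rintro (_ | i)
    exacts [hXc.le, hK i]
  · simp only [Fintype.sum_option, Option.elim, hXc]
    omega

lemma degS_le_card (v : W) (S : Finset W) : degS G v S ≤ S.card := card_filter_le _ _

lemma degS_union_le (v : W) (S T : Finset W) : degS G v (S ∪ T) ≤ degS G v S + degS G v T := by
  unfold degS
  rw [filter_union]
  exact card_union_le _ _

lemma degS_mono (v : W) {S T : Finset W} (h : S ⊆ T) : degS G v S ≤ degS G v T :=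
  card_le_card (filter_subset_filter _ h)

lemma degS_biUnion_le {ι : Type} (v : W) (F : Finset ι) (T : ι → Finset W) :
    degS G v (F.biUnion T) ≤ ∑ i ∈ F, degS G v (T i) := by
  unfold degS
  rw [filter_biUnion]
  exact card_biUnion_le

lemma sum_degS_comm (S T : Finset W) : ∑ a ∈ S, degS G a T = ∑ b ∈ T, degS G b S := by
  have := sum_card_bipartiteAbove_eq_sum_card_bipartiteBelow (s := S) (t := T) fun a b => G.Adj a b
  simp only [bipartiteAbove, bipartiteBelow] at this
  unfold degS
  simpa only [G.adj_comm] using this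

lemma sum_degS_le (S T : Finset W) : ∑ a ∈ S, degS G a T ≤ S.card * T.card :=
  (sum_le_card_nsmul _ _ _ fun a _ => degS_le_card a T).trans_eq (by simp)

lemma BicliqueFamily.sum_card_add {ι : Type} [Fintype ι] {S T : ι → Finset W}
    (h : BicliqueFamily G A B S T) :
    ∑ i, (S i).card + (A \ univ.biUnion S).card = A.card := by
  rw [← card_biUnion fun i _ j _ hij => h.disjL i j hij, add_comm]
  exact card_sdiff_add_card_eq_card (biUnion_subset.2 fun i _ => h.subL i)

lemma exists_large_biclique_family {ε : ℝ} (hε : 0 < ε) (hε1 : ε ≤ 1) {H : ℕ} (hH : 1 ≤ H) :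
    ∃ β : ℝ, 0 < β ∧ ∃ n₀ : ℕ, ∀ n : ℕ, n₀ ≤ n →
      ∀ (W : Type) (_ : Fintype W) (_ : DecidableEq W) (G : SimpleGraph W) (A B : Finset W),
        A.card = n → B.card = n →
        (∀ a ∈ A, ((1 : ℝ) / 2 - β) * n ≤ (degS G a B : ℝ)) →
        (∀ b ∈ B, ((1 : ℝ) / 2 - β) * n ≤ (degS G b A : ℝ)) →
        ∃ (ι : Type) (_ : Fintype ι) (S T : ι → Finset W), BicliqueFamily G A B S T ∧
          (∀ i, H < (S i).card) ∧ ((A \ univ.biUnion S).card : ℝ) ≤ ε * n := by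
  set δ := ε / 12 with hδ
  have hδ0 : 0 < δ := by positivity
  obtain ⟨M₂, N₂, hK₂⟩ := exists_complete_subrelation hδ0 (3 * H) (3 * H)
  obtain ⟨M₁, N₁, hK₁⟩ := exists_complete_subrelation hδ0 M₂ (3 * H)
  refine ⟨δ, hδ0, ⌈((N₁ : ℝ) + N₂ + 2 * (2 * M₂ + 6 * H * M₁) * 2) / ε⌉₊,
    fun n hn W _ _ G A B hA hB hdA hdB => ?_⟩
  have hn' : (N₁ : ℝ) + N₂ + 2 * (2 * M₂ + 6 * H * M₁) * 2 ≤ ε * n := by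
    have := (Nat.le_ceil _).trans (Nat.cast_le (α := ℝ).2 hn)
    rw [div_le_iff₀ hε] at this
    linarith
  have hHM : (0 : ℝ) ≤ 2 * (2 * M₂ + 6 * H * M₁) * 2 := by positivity
  obtain ⟨ι, _, S, T, hF, hsize, hmax⟩ := exists_maximal_family G A B H (3 * H)
  refine ⟨ι, inferInstance, S, T, hF, fun i => (hsize i).1, ?_⟩
  have hcA := hF.sum_card_add
  have hcB := hF.symm.sum_card_add
  simp only [← hF.card_eq] at hcB
  set A₀ := A \ univ.biUnion S with hA₀
  set B₀ := B \ univ.biUnion T with hB₀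
  have hAB : B₀.card = A₀.card := by omega
  set L := A₀.card with hL
  by_cases hLN : L < N₁ + N₂
  · have : (L : ℝ) ≤ N₁ + N₂ := by exact_mod_cast hLN.le
    linarith
  push Not at hLN
  have hdisjA : ∀ {X : Finset W}, X ⊆ A₀ → ∀ i, Disjoint X (S i) := fun hX i =>
    (sdiff_disjoint.mono_right (subset_biUnion_of_mem S (mem_univ i))).mono_left hX
  have hdisjB : ∀ {X : Finset W}, X ⊆ B₀ → ∀ i, Disjoint X (T i) := fun hX i =>
    (sdiff_disjoint.mono_right (subset_biUnion_of_mem T (mem_univ i))).mono_left hX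
  have hD : (A₀.filter fun a => δ * L ≤ degS G a B₀).card ≤ M₂ := by
    by_contra hlt
    push Not at hlt
    obtain ⟨X, hX, hXc, Y, hY, hYc, hXY⟩ := hK₂ _ B₀ (fun a b => G.Adj a b) hlt.le
      (by omega) (fun a ha => by rw [hAB]; exact (mem_filter.1 ha).2)
    have hX' := hX.trans (filter_subset _ _)
    obtain ⟨κ, _, S', T', hF', hK', hlt⟩ := hF.extend hH (fun i => (hsize i).2)
      (hX'.trans sdiff_subset) (hY.trans sdiff_subset) (hdisjA hX') (hdisjB hY) hXc hYc hXY
    exact absurd (hmax κ _ S' T' hF' hK') (not_le.2 hlt)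
  set g : Finset ι := univ.filter fun i =>
    (∃ s ∈ S i, δ * L ≤ degS G s B₀) ∧ ∃ t ∈ T i, δ * L ≤ degS G t A₀ with hg
  have hgM : g.card ≤ M₁ := by
    by_contra hlt
    push Not at hlt
    have hs : ∀ i ∈ g, ∃ s ∈ S i, δ * L ≤ degS G s B₀ := fun i hi => (mem_filter.1 hi).2.1
    have ht : ∀ i ∈ g, ∃ t ∈ T i, δ * L ≤ degS G t A₀ := fun i hi => (mem_filter.1 hi).2.2
    have : Nonempty W := by
      obtain ⟨i, hi⟩ := card_pos.1 (by omega : 0 < g.card)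
      exact ⟨(hs i hi).choose⟩
    choose! s hsS hsd using hs
    choose! t htT htd using ht
    obtain ⟨J₁, hJ₁, hJ₁c, Y, hY, hYc, hsY⟩ := hK₁ g B₀ (fun i b => G.Adj (s i) b) hlt.le
      (by omega) (fun i hi => by rw [hAB]; exact hsd i hi)
    obtain ⟨J, hJ, hJc, X, hX, hXc, htX⟩ := hK₂ J₁ A₀ (fun i b => G.Adj (t i) b) hJ₁c.ge
      (by omega) (fun i hi => htd i (hJ₁ hi))
    obtain ⟨κ, _, S', T', hF', hK', hlt⟩ := hF.exchange hH (fun i => (hsize i).2) J hJc s t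
      (fun i hi => hsS i (hJ₁ (hJ hi))) (fun i hi => htT i (hJ₁ (hJ hi)))
      (hX.trans sdiff_subset) (hY.trans sdiff_subset) (hdisjA hX) (hdisjB hY) hXc hYc
      (fun i hi => hsY i (hJ hi)) htX
    exact absurd (hmax κ _ S' T' hF' hK') (not_le.2 hlt)
  have hX0 : (∑ a ∈ A₀, (degS G a B₀ : ℝ)) ≤ M₂ * L + L * (δ * L) := by
    have h1 : ∀ a ∈ A₀, (degS G a B₀ : ℝ) ≤ (if δ * L ≤ degS G a B₀ then (L : ℝ) else 0) + δ * L := by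
      intro a ha
      have h2 : (degS G a B₀ : ℝ) ≤ L := by exact_mod_cast (degS_le_card a B₀).trans_eq hAB
      have h3 : 0 ≤ δ * L := by positivity
      split_ifs <;> linarith
    refine (sum_le_sum h1).trans ?_
    rw [sum_add_distrib, ← sum_filter, sum_const, sum_const, nsmul_eq_mul, nsmul_eq_mul]
    gcongr
  have htile : ∀ i, (∑ b ∈ T i, (degS G b A₀ : ℝ)) + ∑ a ∈ S i, (degS G a B₀ : ℝ) ≤
      (S i).card * (L * (1 + δ)) + if i ∈ g then (6 * H * L : ℝ) else 0 := by
    intro i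
    have b1 : (∑ b ∈ T i, (degS G b A₀ : ℝ)) ≤ (S i).card * L := by
      have := sum_degS_le (G := G) (T i) A₀
      rw [← hF.card_eq] at this
      exact_mod_cast this
    have b2 : (∑ a ∈ S i, (degS G a B₀ : ℝ)) ≤ (S i).card * L := by
      have := sum_degS_le (G := G) (S i) B₀
      rw [hAB] at this
      exact_mod_cast this
    have b3 : (0 : ℝ) ≤ (S i).card * L * δ := by positivity
    split_ifs with hi
    · have b4 : ((S i).card : ℝ) * L ≤ 3 * H * L := by
        gcongr
        exact_mod_cast (hsize i).2
      nlinarith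
    · have : (∀ s ∈ S i, (degS G s B₀ : ℝ) ≤ δ * L) ∨ ∀ t ∈ T i, (degS G t A₀ : ℝ) ≤ δ * L := by
        by_contra hcon
        push Not at hcon
        obtain ⟨⟨s, hs, hs'⟩, t, ht, ht'⟩ := hcon
        exact hi (mem_filter.2 ⟨mem_univ _, ⟨s, hs, hs'.le⟩, t, ht, ht'.le⟩)
      rcases this with h | h
      · have := sum_le_card_nsmul _ _ _ h
        rw [nsmul_eq_mul] at this
        nlinarith
      · have := sum_le_card_nsmul _ _ _ h
        rw [nsmul_eq_mul, ← hF.card_eq] at this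
        nlinarith
  have hsumtile := sum_le_sum fun i (_ : i ∈ univ) => htile i
  rw [sum_add_distrib, sum_add_distrib, ← sum_mul, ← sum_filter, sum_const, nsmul_eq_mul,
    filter_mem_eq_inter, univ_inter] at hsumtile
  have split : ∀ (X Y : Finset W) (T : ι → Finset W) (v : W),
      degS G v Y ≤ degS G v (Y \ univ.biUnion T) + ∑ i, degS G v (T i) := fun X Y T v =>
    calc _ ≤ degS G v ((Y \ univ.biUnion T) ∪ univ.biUnion T) :=
          degS_mono _ (by rw [sdiff_union_self_eq_union]; exact subset_union_left)
      _ ≤ _ := degS_union_le _ _ _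
      _ ≤ _ := by gcongr; exact degS_biUnion_le _ _ _
  have lower : ∀ (X Y : Finset W) (T : ι → Finset W),
      (∀ a ∈ X, ((1 : ℝ) / 2 - δ) * n ≤ (degS G a Y : ℝ)) →
      X.card * (((1 : ℝ) / 2 - δ) * n) ≤ (∑ a ∈ X, (degS G a (Y \ univ.biUnion T) : ℝ)) +
        ∑ i, ∑ b ∈ T i, (degS G b X : ℝ) := by
    intro X Y T h
    have h1 := card_nsmul_le_sum _ _ _ h
    rw [nsmul_eq_mul] at h1
    refine h1.trans ?_
    have h2 := sum_le_sum fun a (_ : a ∈ X) => split X Y T a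
    rw [sum_add_distrib, sum_comm] at h2
    simp only [sum_degS_comm (G := G) X (T _)] at h2
    exact_mod_cast h2
  have lA := lower A₀ B T fun a ha => hdA a (mem_sdiff.1 ha).1
  have lB := lower B₀ A S fun a ha => hdB a (mem_sdiff.1 ha).1
  have hcomm : (∑ b ∈ B₀, (degS G b A₀ : ℝ)) = ∑ a ∈ A₀, (degS G a B₀ : ℝ) := by
    exact_mod_cast sum_degS_comm (G := G) B₀ A₀
  rw [← hA₀, hcomm, hAB] at lB
  rw [← hB₀, ← hL] at lA
  have hcA' : (∑ i, ((S i).card : ℝ)) = n - L := by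
    rw [eq_sub_iff_add_eq, ← hA]
    exact_mod_cast hcA
  rw [hcA'] at hsumtile
  have hgM' : (g.card : ℝ) * (6 * H * L) ≤ M₁ * (6 * H * L) := by gcongr
  rcases Nat.eq_zero_or_pos L with h0 | hLpos
  · rw [h0]; push_cast; positivity
  have hLpos' : (0 : ℝ) < L := by exact_mod_cast hLpos
  have key : L * ((1 - 2 * δ) * n) ≤
      L * (2 * M₂ + 2 * δ * L + (n - L) * (1 + δ) + 6 * H * M₁ : ℝ) := by nlinarith
  have key' := le_of_mul_le_mul_left key hLpos'
  have hδ1 : δ ≤ 1 / 12 := by rw [hδ]; linarith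
  have : (L : ℝ) * (1 - δ) ≤ 3 * δ * n + (2 * M₂ + 6 * H * M₁) := by nlinarith
  have h12 : ε = 12 * δ := by rw [hδ]; ring
  rw [h12] at hn' ⊢
  nlinarith [Nat.cast_nonneg (α := ℝ) N₁, Nat.cast_nonneg (α := ℝ) N₂]

lemma BicliqueFamily.mono {A' B' : Finset W} {ι : Type} {S T : ι → Finset W}
    (h : BicliqueFamily G A B S T) (hA : A ⊆ A') (hB : B ⊆ B') : BicliqueFamily G A' B' S T :=
  { h with
    subL := fun i => (h.subL i).trans hA
    subR := fun i => (h.subR i).trans hB }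

/-- An almost perfect tiling with copies of `K_{h,h}`. -/
lemma exists_almost_perfect_tiling {ε : ℝ} (hε : 0 < ε) (hε1 : ε ≤ 1) {h : ℕ} (hh : 1 ≤ h) :
    ∃ β : ℝ, 0 < β ∧ ∃ n₀ : ℕ, ∀ n : ℕ, n₀ ≤ n →
      ∀ (W : Type) (_ : Fintype W) (_ : DecidableEq W) (G : SimpleGraph W) (A B : Finset W),
        A.card = n → B.card = n →
        (∀ a ∈ A, ((1 : ℝ) / 2 - β) * n ≤ (degS G a B : ℝ)) →
        (∀ b ∈ B, ((1 : ℝ) / 2 - β) * n ≤ (degS G b A : ℝ)) →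
        ∃ (ι : Type) (_ : Fintype ι) (S T : ι → Finset W), BicliqueFamily G A B S T ∧
          (∀ i, (S i).card = h) ∧ ((A \ univ.biUnion S).card : ℝ) ≤ ε * n := by
  have hH : 1 ≤ h * ⌈2 / ε⌉₊ := Nat.mul_pos hh (Nat.ceil_pos.2 (by positivity))
  obtain ⟨β, hβ, n₀, hn₀⟩ := exists_large_biclique_family (half_pos hε) (by linarith) hH
  refine ⟨β, hβ, n₀, fun n hn W _ _ G A B hA hB hdA hdB => ?_⟩
  obtain ⟨ι, _, S, T, hF, hsize, hleft⟩ :=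
    hn₀ n hn W inferInstance inferInstance G A B hA hB hdA hdB
  have hS : ∀ i, ∃ X ⊆ S i, X.card = h * ((S i).card / h) := fun i =>
    exists_subset_card_eq (Nat.mul_div_le _ _)
  have hT : ∀ i, ∃ X ⊆ T i, X.card = h * ((S i).card / h) := fun i =>
    exists_subset_card_eq (by rw [hF.card_eq]; exact Nat.mul_div_le _ _)
  choose S' hS' hSc using hS
  choose T' hT' hTc using hT
  have hdS : ∀ i j, i ≠ j → Disjoint (S' i) (S' j) := fun i j hij =>
    (hF.disjL i j hij).mono (hS' i) (hS' j)
  obtain ⟨κ, _, X, Y, hXY, hXc, hX, -⟩ := (PairTileable.biUnion univ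
    (fun i _ => PairTileable.of_complete (G := G) _ (hSc i) (hTc i)
      fun u hu v hv => hF.adj i u (hS' i hu) v (hT' i hv)) hdS
    fun i j hij => (hF.disjR i j hij).mono (hT' i) (hT' j)).exists_family
  refine ⟨κ, inferInstance, X, Y, hXY.mono
    (biUnion_subset.2 fun i _ => (hS' i).trans (hF.subL i))
    (biUnion_subset.2 fun i _ => (hT' i).trans (hF.subR i)), hXc, ?_⟩
  have h1 := hF.sum_card_add
  have h2 := card_sdiff_add_card_eq_card (s := univ.biUnion S') (t := A)
    (biUnion_subset.2 fun i _ => (hS' i).trans (hF.subL i))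
  rw [card_biUnion fun i _ j _ hij => hdS i j hij] at h2
  have h3 : ∑ i, (S i).card ≤ ∑ i, ((S' i).card + h) := sum_le_sum fun i _ => by
    have := Nat.div_add_mod (S i).card h
    have := Nat.mod_lt (S i).card hh
    rw [hSc]
    omega
  rw [sum_add_distrib, sum_const, smul_eq_mul] at h3
  have h4 : (univ : Finset ι).card * (h * ⌈2 / ε⌉₊) ≤ A.card :=
    (card_nsmul_le_sum _ _ _ fun i _ => (hsize i).le).trans hF.sum_card_le
  have h5 : ((univ : Finset ι).card : ℝ) * h ≤ ε / 2 * n := by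
    have h6 : ((univ : Finset ι).card : ℝ) * (h * (2 / ε)) ≤ n := by
      refine le_trans (b := (((univ : Finset ι).card * (h * ⌈2 / ε⌉₊) : ℕ) : ℝ)) ?_
        (by rw [← hA]; exact_mod_cast h4)
      push_cast
      gcongr
      exact Nat.le_ceil _
    have : ((univ : Finset ι).card : ℝ) * (h * (2 / ε)) =
      (univ : Finset ι).card * h * 2 / ε := by ring
    rw [this, div_le_iff₀ hε] at h6
    linarith
  have h7 : (A \ univ.biUnion X).card ≤
      (A \ univ.biUnion S).card + (univ : Finset ι).card * h := by
    rw [hX]; omega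
  have h8 : ((A \ univ.biUnion X).card : ℝ) ≤
      (A \ univ.biUnion S).card + (univ : Finset ι).card * h := by exact_mod_cast h7
  linarith

end AlmostTiling

section Routing

variable {W : Type} [Fintype W] [DecidableEq W] {G : SimpleGraph W} {A B : Finset W}

/-- The vertex classes `A` and `B` have size `n`, the degrees between them are almost `n / 2`, and
all pairs of halves of `A` and `B` are dense. -/
structure NonExtremal (G : SimpleGraph W) (A B : Finset W) (n : ℕ) (κ : ℝ) : Prop where
  cardL : A.card = n
  cardR : B.card = n
  degL : ∀ a ∈ A, ((1 : ℝ) / 2 - κ) * n ≤ (degS G a B : ℝ)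
  degR : ∀ b ∈ B, ((1 : ℝ) / 2 - κ) * n ≤ (degS G b A : ℝ)
  dense : ∀ X ⊆ A, ∀ Y ⊆ B, X.card = n / 2 → Y.card = n / 2 →
    8 * κ * n ^ 2 < (∑ x ∈ X, degS G x Y : ℕ)

lemma NonExtremal.symm {n : ℕ} {κ : ℝ} (h : NonExtremal G A B n κ) : NonExtremal G B A n κ :=
  ⟨h.cardR, h.cardL, h.degR, h.degL, fun X hX Y hY hXc hYc => by
    rw [sum_degS_comm]; exact h.dense Y hY X hX hYc hXc⟩

lemma exists_half_close {n : ℕ} {c : ℝ} (hc : 0 ≤ c) {P : Finset W} (hP : P ⊆ A)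
    (hA : A.card = n) (hPc : ((1 : ℝ) / 2 - c) * n ≤ P.card) :
    ∃ X ⊆ A, X.card = n / 2 ∧ ((X \ P).card : ℝ) ≤ c * n := by
  rcases le_total (n / 2) P.card with h | h
  · obtain ⟨X, hX, hXc⟩ := exists_subset_card_eq h
    refine ⟨X, hX.trans hP, hXc, ?_⟩
    rw [sdiff_eq_empty_iff_subset.2 hX]
    simp only [card_empty, Nat.cast_zero]
    positivity
  · obtain ⟨X, hPX, hXA, hXc⟩ := exists_subsuperset_card_eq hP h (by omega)
    refine ⟨X, hXA, hXc, ?_⟩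
    rw [card_sdiff_of_subset hPX, Nat.cast_sub (card_le_card hPX), hXc]
    have : ((n / 2 : ℕ) : ℝ) ≤ n / 2 := Nat.cast_div_le
    linarith

lemma sum_degS_le_add (X Y P Q : Finset W) :
    ∑ x ∈ X, degS G x Y ≤
      ∑ x ∈ P, degS G x Q + (X \ P).card * Q.card + X.card * (Y \ Q).card := by
  have h1 : ∀ x ∈ X, degS G x Y ≤ degS G x Q + (Y \ Q).card := fun x _ =>
    (degS_mono x (by rw [union_sdiff_self_eq_union]; exact subset_union_right)).trans
      ((degS_union_le x Q (Y \ Q)).trans (by gcongr; exact degS_le_card x _))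
  have h2 : ∑ x ∈ X, degS G x Q ≤ ∑ x ∈ P ∪ X \ P, degS G x Q :=
    sum_le_sum_of_subset (by rw [union_sdiff_self_eq_union]; exact subset_union_right)
  rw [sum_union disjoint_sdiff] at h2
  have h3 := sum_degS_le (G := G) (X \ P) Q
  have h4 := sum_le_sum h1
  rw [sum_add_distrib, sum_const, smul_eq_mul] at h4
  omega

lemma BicliqueFamily.card_biUnion_eq {ι : Type} {S T : ι → Finset W} {h : ℕ}
    (hF : BicliqueFamily G A B S T) (hc : ∀ i, (S i).card = h) (F : Finset ι) :
    (F.biUnion S).card = F.card * h := by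
  rw [card_biUnion fun i _ j _ hij => hF.disjL i j hij]
  simp [hc]

lemma NonExtremal.exists_route {n h θ : ℕ} {κ : ℝ} (hN : NonExtremal G A B n κ) {ι : Type}
    {S T : ι → Finset W} (hF : BicliqueFamily G A B S T) (hc : ∀ i, (S i).card = h)
    (hh : 1 ≤ h) (hκ : 0 ≤ κ) (hθ : θ ≤ κ * h) (hn : h ≤ κ * n) {F : Finset ι}
    (hFc : (1 - κ) * n ≤ F.card * h) {a : W} (ha : a ∈ A) {T₀ : Finset W} (hT₀ : T₀ ⊆ B)
    (hT₀c : T₀.card = h) :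
    ∃ i ∈ F, ∃ l ∈ F, i ≠ l ∧ ∃ s ∈ S i, ∃ s' ∈ S l,
      θ ≤ degS G a (T i) ∧ θ ≤ degS G s (T l) ∧ θ ≤ degS G s' T₀ := by
  by_contra! hcon
  have hh' : (0 : ℝ) < h := by exact_mod_cast hh
  have hcT : ∀ i, (T i).card = h := fun i => by rw [← hF.card_eq, hc]
  have hS : ∀ I : Finset ι, I.biUnion S ⊆ A := fun I => biUnion_subset.2 fun i _ => hF.subL i
  have hT : ∀ I : Finset ι, I.biUnion T ⊆ B := fun I => biUnion_subset.2 fun i _ => hF.subR i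
  have cardle : ∀ I : Finset ι, (I.card : ℝ) * h ≤ n := fun I => by
    have := card_le_card (hS I)
    rw [hF.card_biUnion_eq hc, hN.cardL] at this
    exact_mod_cast this
  have cardθ : ∀ I : Finset ι, (I.card : ℝ) * θ ≤ κ * n := fun I =>
    calc (I.card : ℝ) * θ ≤ I.card * (κ * h) := by gcongr
      _ = κ * (I.card * h) := by ring
      _ ≤ κ * n := by gcongr; exact cardle I
  have hrestA : ((A \ F.biUnion S).card : ℝ) ≤ κ * n := by
    rw [card_sdiff_of_subset (hS F), Nat.cast_sub (card_le_card (hS F)), hF.card_biUnion_eq hc,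
      hN.cardL]
    push_cast
    linarith
  have hrestB : ((B \ F.biUnion T).card : ℝ) ≤ κ * n := by
    rw [card_sdiff_of_subset (hT F), Nat.cast_sub (card_le_card (hT F)),
      hF.symm.card_biUnion_eq hcT, hN.cardR]
    push_cast
    linarith
  set I := F.filter fun i => θ ≤ degS G a (T i) with hI
  set J := F.filter fun l => ∃ s ∈ S l, θ ≤ degS G s T₀ with hJ
  have hIc : (1 / 2 - 3 * κ) * n ≤ I.card * h := by
    have h1 : degS G a B ≤ (B \ F.biUnion T).card + ∑ i ∈ F, degS G a (T i) :=
      calc degS G a B ≤ degS G a ((B \ F.biUnion T) ∪ F.biUnion T) :=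
            degS_mono _ (by rw [sdiff_union_self_eq_union]; exact subset_union_left)
        _ ≤ _ := degS_union_le _ _ _
        _ ≤ _ := by gcongr; exacts [degS_le_card _ _, degS_biUnion_le _ _ _]
    have h2 : ∑ i ∈ F, degS G a (T i) ≤ ∑ i ∈ F, ((if θ ≤ degS G a (T i) then h else 0) + θ) := by
      refine sum_le_sum fun i _ => ?_
      have := degS_le_card (G := G) a (T i)
      rw [hcT] at this
      split_ifs <;> omega
    rw [sum_add_distrib, ← sum_filter, sum_const, sum_const, smul_eq_mul, smul_eq_mul] at h2
    replace h2 : ∑ i ∈ F, degS G a (T i) ≤ I.card * h + F.card * θ := by convert h2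
    have h3 : (degS G a B : ℝ) ≤ (B \ F.biUnion T).card + (I.card * h + F.card * θ) := by
      exact_mod_cast h1.trans (by omega)
    linarith [cardθ F, hN.degL a ha]
  have hJc : (1 / 2 - 3 * κ) * n ≤ J.card * h := by
    have h1 : ∑ x ∈ A, degS G x T₀ ≤ (A \ F.biUnion S).card * h +
        ∑ i ∈ F, ∑ s ∈ S i, degS G s T₀ := by
      rw [← sum_sdiff (hS F), sum_biUnion fun i _ j _ hij => hF.disjL i j hij]
      gcongr
      rw [← hT₀c]
      exact sum_degS_le _ _
    have h2 : ∑ i ∈ F, ∑ s ∈ S i, degS G s T₀ ≤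
        ∑ i ∈ F, ((if ∃ s ∈ S i, θ ≤ degS G s T₀ then h * h else 0) + h * θ) := by
      refine sum_le_sum fun i _ => ?_
      split_ifs with hi
      · have := sum_degS_le (G := G) (S i) T₀
        rw [hc, hT₀c] at this
        omega
      · push Not at hi
        have := sum_le_card_nsmul _ _ _ fun s hs => (hi s hs).le
        rw [hc, smul_eq_mul] at this
        omega
    rw [sum_add_distrib, ← sum_filter, sum_const, sum_const, smul_eq_mul, smul_eq_mul] at h2
    replace h2 : ∑ i ∈ F, ∑ s ∈ S i, degS G s T₀ ≤ J.card * (h * h) + F.card * (h * θ) := by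
      convert h2
    have h3 := card_nsmul_le_sum _ _ _ fun b hb => hN.degR b (hT₀ hb)
    rw [nsmul_eq_mul, hT₀c] at h3
    have h4 : (∑ b ∈ T₀, (degS G b A : ℝ)) ≤
        (A \ F.biUnion S).card * h + (J.card * (h * h) + F.card * (h * θ)) := by
      have := sum_degS_comm (G := G) T₀ A
      exact_mod_cast this.le.trans (h1.trans (by omega))
    have h5 : (h : ℝ) * ((1 / 2 - κ) * n) ≤
        h * ((A \ F.biUnion S).card + J.card * h + F.card * θ) := by nlinarith
    linarith [le_of_mul_le_mul_left h5 hh', cardθ F]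
  have hPQ : (∑ x ∈ I.biUnion S, degS G x (J.biUnion T) : ℕ) ≤ 2 * κ * n ^ 2 := by
    have h1 : ∀ x ∈ I.biUnion S, degS G x (J.biUnion T) ≤ J.card * θ + h := by
      intro x hx
      obtain ⟨i, hi, hx⟩ := mem_biUnion.1 hx
      have hi' := mem_filter.1 hi
      calc degS G x (J.biUnion T) ≤ ∑ l ∈ J, degS G x (T l) := degS_biUnion_le _ _ _
        _ ≤ ∑ l ∈ J, (θ + if l = i then h else 0) := by
            refine sum_le_sum fun l hl => ?_
            split_ifs with hli
            · have := degS_le_card (G := G) x (T l)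
              rw [hcT] at this
              omega
            · obtain ⟨hlF, s', hs', hθ'⟩ := mem_filter.1 hl
              by_contra hlt
              exact absurd hθ' (not_le.2 (hcon i hi'.1 l hlF (Ne.symm hli) x hx s' hs' hi'.2
                (by omega)))
        _ ≤ J.card * θ + h := by
            rw [sum_add_distrib, sum_const, smul_eq_mul, sum_ite_eq']
            split_ifs <;> omega
    have h2 := sum_le_card_nsmul _ _ _ h1
    rw [smul_eq_mul, hF.card_biUnion_eq hc] at h2
    calc ((∑ x ∈ I.biUnion S, degS G x (J.biUnion T) : ℕ) : ℝ)
        ≤ I.card * h * (J.card * θ + h) := by exact_mod_cast h2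
      _ ≤ n * (κ * n + κ * n) := mul_le_mul (cardle I) (add_le_add (cardθ J) hn) (by positivity)
          (by positivity)
      _ = 2 * κ * n ^ 2 := by ring
  obtain ⟨X, hXA, hXc, hXP⟩ := exists_half_close (c := 3 * κ) (by positivity) (hS I) hN.cardL
    (by rw [hF.card_biUnion_eq hc]; push_cast; exact hIc)
  obtain ⟨Y, hYB, hYc, hYQ⟩ := exists_half_close (c := 3 * κ) (by positivity) (hT J) hN.cardR
    (by rw [hF.symm.card_biUnion_eq hcT]; push_cast; exact hJc)
  have hfin := sum_degS_le_add (G := G) X Y (I.biUnion S) (J.biUnion T)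
  have hfin' : ((∑ x ∈ X, degS G x Y : ℕ) : ℝ) ≤
      (∑ x ∈ I.biUnion S, degS G x (J.biUnion T) : ℕ) +
        (X \ I.biUnion S).card * (J.biUnion T).card + X.card * (Y \ J.biUnion T).card := by
    exact_mod_cast hfin
  have hQn : ((J.biUnion T).card : ℝ) ≤ n := by
    rw [← hN.cardR]; exact_mod_cast card_le_card (hT J)
  have hXn : (X.card : ℝ) ≤ n := by
    rw [← hN.cardL]; exact_mod_cast card_le_card hXA
  have e1 : ((X \ I.biUnion S).card : ℝ) * (J.biUnion T).card ≤ 3 * κ * n * n := by gcongr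
  have e2 : (X.card : ℝ) * (Y \ J.biUnion T).card ≤ n * (3 * κ * n) := by gcongr
  have := hN.dense X hXA Y hYB hXc hYc
  nlinarith

lemma BicliqueFamily.disjoint_biUnion {ι : Type} {S T : ι → Finset W}
    (hF : BicliqueFamily G A B S T) {I J : Finset ι} (hIJ : Disjoint I J) :
    Disjoint (I.biUnion S) (J.biUnion S) := by
  simp only [disjoint_biUnion_left, disjoint_biUnion_right]
  exact fun i hi j hj => hF.disjL j i fun h => (disjoint_left.1 hIJ) (h ▸ hj) hi

lemma BicliqueFamily.disjoint_biUnion_right {ι : Type} {S T : ι → Finset W}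
    (hF : BicliqueFamily G A B S T) {i : ι} {J : Finset ι} (hi : i ∉ J) :
    Disjoint (S i) (J.biUnion S) := by
  simpa using hF.disjoint_biUnion (disjoint_singleton_left.2 hi)

/-- Every set `Z` outside the bicliques can be exchanged, at the cost of a few bicliques, for a set
`X` of vertices having many neighbours in `T₀`. -/
lemma NonExtremal.exists_exchange {n h θ r : ℕ} {κ : ℝ} (hN : NonExtremal G A B n κ) {ι : Type}
    {S T : ι → Finset W} (hF : BicliqueFamily G A B S T) (hc : ∀ i, (S i).card = h)
    (hr : 1 ≤ r) (hrh : r ∣ h) (hlt : r < h) (hrθ : r ≤ θ) (hκ : 0 ≤ κ) (hθ : θ ≤ κ * h)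
    (hn : h ≤ κ * n) {F : Finset ι} {T₀ : Finset W} (hT₀ : T₀ ⊆ B) (hT₀c : T₀.card = h)
    {Z : Finset W} (hZ : Z ⊆ A) (hZF : Disjoint (F.biUnion S) Z)
    (hFc : (1 - κ) * n + 2 * h * Z.card ≤ F.card * h) :
    ∃ F' ⊆ F, F.card ≤ F'.card + 2 * Z.card ∧ ∃ X P : Finset W, X.card = Z.card ∧
      (∀ x ∈ X, θ ≤ degS G x T₀) ∧ Disjoint P X ∧ P ∪ X = (F \ F').biUnion S ∪ Z ∧
      PairTileable G r P ((F \ F').biUnion T) := by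
  induction Z using Finset.induction_on with
  | empty =>
    refine ⟨F, Subset.rfl, by simp, ∅, ∅, by simp, by simp, by simp, by simp, ?_⟩
    simpa using PairTileable.empty
  | insert a Z ha ih =>
    rw [card_insert_of_notMem ha] at *
    push_cast at hFc
    rw [insert_subset_iff] at hZ
    rw [disjoint_insert_right] at hZF
    have hh' : (0 : ℝ) ≤ h := by positivity
    obtain ⟨F', hF', hcard, X, P, hXc, hX, hPX, hU, htile⟩ := ih hZ.2 hZF.2 (by nlinarith)
    have hcard' : (F.card : ℝ) ≤ F'.card + 2 * Z.card := by exact_mod_cast hcard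
    obtain ⟨i, hi, l, hl, hil, s, hs, s', hs', hai, hsl, hs0⟩ :=
      hN.exists_route hF hc (by omega) hκ hθ hn (F := F') (by nlinarith) hZ.1 hT₀ hT₀c
    have hD : F \ (F' \ {i, l}) = insert i (insert l (F \ F')) := by
      ext j
      simp only [mem_sdiff, mem_insert, mem_singleton]
      by_cases h1 : j = i
      · subst h1; simp [hF' hi]
      · by_cases h2 : j = l
        · subst h2; simp [hF' hl]
        · simp [h1, h2]
    have hiD : Disjoint (S i) ((F \ F').biUnion S) :=
      hF.disjoint_biUnion_right (by simp [hi])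
    have hlD : Disjoint (S l) ((F \ F').biUnion S) :=
      hF.disjoint_biUnion_right (by simp [hl])
    have hiD' : Disjoint (T i) ((F \ F').biUnion T) :=
      hF.symm.disjoint_biUnion_right (by simp [hi])
    have hlD' : Disjoint (T l) ((F \ F').biUnion T) :=
      hF.symm.disjoint_biUnion_right (by simp [hl])
    have hSil := hF.disjL i l hil
    have hTil := hF.disjR i l hil
    have hsub : ∀ j ∈ F, S j ⊆ F.biUnion S := fun j hj => subset_biUnion_of_mem S hj
    have hDsub : (F \ F').biUnion S ⊆ F.biUnion S := biUnion_subset_biUnion_of_subset_left _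
      sdiff_subset
    have haU : a ∉ (F \ F').biUnion S := fun h => hZF.1 (hDsub h)
    have hai' : a ∉ S i := fun h => hZF.1 (hsub i (hF' hi) h)
    have hal' : a ∉ S l := fun h => hZF.1 (hsub l (hF' hl) h)
    have hiZ : Disjoint (S i) Z := hZF.2.mono_left (hsub i (hF' hi))
    have hlZ : Disjoint (S l) Z := hZF.2.mono_left (hsub l (hF' hl))
    have hmem : ∀ x, x ∈ P ∨ x ∈ X ↔ x ∈ (F \ F').biUnion S ∨ x ∈ Z := fun x => by
      rw [← mem_union, hU, mem_union]
    rw [disjoint_left] at hiD hlD hSil hiZ hlZ hPX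
    have hsil : s ∉ S l := hSil hs
    have hsil' : s' ∉ S i := fun h => hSil h hs'
    obtain ⟨k, hk⟩ := hrh
    have tile : ∀ j x y, x ∈ S j → y ∉ S j → r ≤ degS G y (T j) →
        PairTileable G r ((S j).erase x ∪ {y}) (T j) := fun j x y hx hy hd =>
      PairTileable.of_core_left hr _ _ _ k (by simp [hy])
        (by rw [card_erase_of_mem hx, hc, card_singleton]; omega)
        (by rw [← hF.card_eq, hc, hk]) (fun u hu => hF.adj j u (mem_of_mem_erase hu))
        (by simpa using hd) (by rw [card_erase_of_mem hx, hc, card_singleton]; omega)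
    have t := (htile.union (tile i s a hs hai' (hrθ.trans hai)) (by
      rw [disjoint_left]; grind) hiD'.symm).union (tile l s' s hs' hsil (hrθ.trans hsl)) (by
      rw [disjoint_left]; grind) (disjoint_union_left.2 ⟨hlD'.symm, hTil⟩)
    refine ⟨F' \ {i, l}, sdiff_subset.trans hF', ?_, insert s' X,
      P ∪ ((S i).erase s ∪ {a}) ∪ ((S l).erase s' ∪ {s}), ?_, ?_, ?_, ?_, ?_⟩
    · have : ({i, l} : Finset ι).card ≤ 2 := card_le_two
      have := le_card_sdiff {i, l} F'
      omega
    · rw [card_insert_of_notMem (by grind), hXc]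
    · intro x hx
      rcases mem_insert.1 hx with rfl | hx
      exacts [hs0, hX x hx]
    · rw [disjoint_left]; grind
    · rw [hD, biUnion_insert, biUnion_insert]
      ext x
      have := hmem x
      grind
    · rw [hD, biUnion_insert, biUnion_insert]
      convert t using 1
      ext x
      simp only [mem_union]
      tauto

set_option maxHeartbeats 1000000 in
/-- A family of bicliques covering almost everything can be turned into a perfect tiling with
copies of `K_{r,r}` that also uses the remaining vertices `A₀` and `B₀`. -/
lemma NonExtremal.pairTileable {n h r : ℕ} {κ : ℝ} (hN : NonExtremal G A B n κ) {ι : Type}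
    {S T : ι → Finset W} (hF : BicliqueFamily G A B S T) (hc : ∀ i, (S i).card = h)
    (hr : 1 ≤ r) (hrh : r ∣ h) (hh : 2 * r * r ≤ h) (hκ : 0 ≤ κ) (hκ1 : κ ≤ 1)
    (hθ : (2 * r * r : ℕ) ≤ κ * h) (hn : h ≤ κ * n) (g : ℕ) {F : Finset ι} {A₀ B₀ : Finset W}
    (hA₀ : A₀ ⊆ A) (hB₀ : B₀ ⊆ B) (hA₀c : A₀.card = r * g) (hB₀c : B₀.card = r * g)
    (hFA : Disjoint (F.biUnion S) A₀) (hFB : Disjoint (F.biUnion T) B₀)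
    (hFc : (1 - κ) * n + 5 * h * r * g ≤ F.card * h) :
    PairTileable G r (F.biUnion S ∪ A₀) (F.biUnion T ∪ B₀) := by
  have hcT : ∀ i, (T i).card = h := fun i => by rw [← hF.card_eq, hc]
  obtain ⟨h', hh'⟩ := hrh
  induction g generalizing F A₀ B₀ with
  | zero =>
    rw [mul_zero, card_eq_zero] at hA₀c hB₀c
    rw [hA₀c, hB₀c, union_empty, union_empty]
    exact PairTileable.biUnion F (fun i _ => PairTileable.of_complete h' (by rw [hc, hh'])
      (by rw [hcT, hh']) (hF.adj i)) hF.disjL hF.disjR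
  | succ g ih =>
    have hrr : 2 * r ≤ 2 * r * r := Nat.le_mul_of_pos_right _ hr
    have hhr : (h : ℝ) ≤ h * r := le_mul_of_one_le_right (by positivity) (by exact_mod_cast hr)
    have hhg : (0 : ℝ) ≤ h * r * g := by positivity
    have hhpos : (0 : ℝ) < h := by exact_mod_cast (by omega : 0 < h)
    have hrpos : (0 : ℝ) < r := by exact_mod_cast hr
    have hκn : 0 ≤ (1 - κ) * n := mul_nonneg (by linarith) (by positivity)
    push_cast at hFc
    obtain ⟨k, hk⟩ : F.Nonempty := by
      rw [nonempty_iff_ne_empty]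
      rintro rfl
      simp only [card_empty, Nat.cast_zero, zero_mul] at hFc
      nlinarith
    obtain ⟨A₁, hA₁, hA₁c⟩ := exists_subset_card_eq (s := A₀) (n := r) (by nlinarith)
    obtain ⟨B₁, hB₁, hB₁c⟩ := exists_subset_card_eq (s := B₀) (n := r) (by nlinarith)
    have hF₁c : ((F.erase k).card : ℝ) = F.card - 1 := by
      rw [card_erase_of_mem hk, Nat.cast_sub (card_pos.2 ⟨k, hk⟩), Nat.cast_one]
    have hF₁ : F.erase k ⊆ F := erase_subset _ _
    obtain ⟨F₂, hF₂, hF₂c, X, P, hXc, hX, hPX, hPU, hP⟩ := hN.exists_exchange hF hc hr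
      ⟨h', hh'⟩ (by omega) (by omega) hκ hθ hn (F := F.erase k) (hF.subR k) (hcT k)
      (hA₁.trans hA₀) (hFA.mono (biUnion_subset_biUnion_of_subset_left _ hF₁) hA₁)
      (by rw [hF₁c, hA₁c]; nlinarith)
    have hF₂c' : ((F.erase k).card : ℝ) ≤ F₂.card + 2 * r := by
      rw [hA₁c] at hF₂c; exact_mod_cast hF₂c
    obtain ⟨F₃, hF₃, hF₃c, Y, Q, hYc, hY, hQY, hQU, hQ⟩ := hN.symm.exists_exchange hF.symm hcT hr
      ⟨h', hh'⟩ (by omega) (by omega) hκ hθ hn (F := F₂) (hF.subL k) (hc k)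
      (hB₁.trans hB₀)
      (hFB.mono (biUnion_subset_biUnion_of_subset_left _ (hF₂.trans hF₁)) hB₁)
      (by rw [hB₁c]; nlinarith)
    have hF₃c' : (F₂.card : ℝ) ≤ F₃.card + 2 * r := by
      rw [hB₁c] at hF₃c; exact_mod_cast hF₃c
    have hF₃F : F₃ ⊆ F := hF₃.trans (hF₂.trans hF₁)
    have key := ih (F := F₃) (sdiff_subset.trans hA₀) (sdiff_subset.trans hB₀)
      (A₀ := A₀ \ A₁) (B₀ := B₀ \ B₁)
      (by rw [card_sdiff_of_subset hA₁, hA₀c, hA₁c, mul_add]; omega)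
      (by rw [card_sdiff_of_subset hB₁, hB₀c, hB₁c, mul_add]; omega)
      (hFA.mono (biUnion_subset_biUnion_of_subset_left _ hF₃F) sdiff_subset)
      (hFB.mono (biUnion_subset_biUnion_of_subset_left _ hF₃F) sdiff_subset) (by nlinarith)
    have hkF₂ : k ∉ F₂ := fun h => by simpa using hF₂ h
    have hd12 : Disjoint (F.erase k \ F₂) (F₂ \ F₃) :=
      disjoint_sdiff.symm.mono_right sdiff_subset
    have hd13 : Disjoint (F.erase k \ F₂) F₃ := disjoint_sdiff.symm.mono_right hF₃
    have hd23 : Disjoint (F₂ \ F₃) F₃ := sdiff_disjoint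
    have hdecomp : F = insert k ((F.erase k \ F₂) ∪ ((F₂ \ F₃) ∪ F₃)) := by
      rw [sdiff_union_of_subset hF₃, sdiff_union_of_subset hF₂, insert_erase hk]
    set D₁ := F.erase k \ F₂ with hD₁
    set D₂ := F₂ \ F₃ with hD₂
    have hk1 : k ∉ D₁ := by simp [hD₁]
    have hk2 : k ∉ D₂ := by simp [hD₂, hkF₂]
    have hk3 : k ∉ F₃ := fun h => hkF₂ (hF₃ h)
    have hSF : F.biUnion S = S k ∪ (D₁.biUnion S ∪ (D₂.biUnion S ∪ F₃.biUnion S)) := by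
      conv_lhs => rw [hdecomp]
      rw [biUnion_insert, union_biUnion, union_biUnion]
    have hTF : F.biUnion T = T k ∪ (D₁.biUnion T ∪ (D₂.biUnion T ∪ F₃.biUnion T)) := by
      conv_lhs => rw [hdecomp]
      rw [biUnion_insert, union_biUnion, union_biUnion]
    rw [hSF] at hFA ⊢
    rw [hTF] at hFB ⊢
    have s1 := hF.disjoint_biUnion_right hk1
    have s2 := hF.disjoint_biUnion_right hk2
    have s3 := hF.disjoint_biUnion_right hk3
    have s12 := hF.disjoint_biUnion hd12
    have s13 := hF.disjoint_biUnion hd13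
    have s23 := hF.disjoint_biUnion hd23
    have t1 := hF.symm.disjoint_biUnion_right hk1
    have t2 := hF.symm.disjoint_biUnion_right hk2
    have t3 := hF.symm.disjoint_biUnion_right hk3
    have t12 := hF.symm.disjoint_biUnion hd12
    have t13 := hF.symm.disjoint_biUnion hd13
    have t23 := hF.symm.disjoint_biUnion hd23
    simp only [disjoint_union_left] at hFA hFB
    have hXS : X ⊆ D₁.biUnion S ∪ A₁ := hPU ▸ subset_union_right
    have hYT : Y ⊆ D₂.biUnion T ∪ B₁ := hQU ▸ subset_union_right
    have hPS : P ⊆ D₁.biUnion S ∪ A₁ := hPU ▸ subset_union_left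
    have hQT : Q ⊆ D₂.biUnion T ∪ B₁ := hQU ▸ subset_union_left
    have dXk : Disjoint (S k) (D₁.biUnion S ∪ A₁) :=
      disjoint_union_right.2 ⟨s1, hFA.1.mono_right hA₁⟩
    have dYk : Disjoint (T k) (D₂.biUnion T ∪ B₁) :=
      disjoint_union_right.2 ⟨t2, hFB.1.mono_right hB₁⟩
    have hXY : r * (X.card + Y.card) = 2 * r * r := by rw [hXc, hYc, hA₁c, hB₁c]; ring
    have core := PairTileable.of_core hr (S k) (T k) X Y (h' + 1) (dXk.mono_right hXS)
      (dYk.mono_right hYT) (by rw [hc, hXc, hA₁c, hh']; ring)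
      (by rw [hcT, hYc, hB₁c, hh']; ring) (hF.adj k) (by rwa [hXY]) (by rwa [hXY])
      (by rwa [hXY, hc]) (by rwa [hXY, hcT])
    have tP := core.union hP
      (disjoint_union_left.2 ⟨dXk.mono_right hPS, hPX.symm⟩)
      (disjoint_union_left.2 ⟨t1, (disjoint_union_right.2
        ⟨t12, hFB.2.1.mono_right hB₁⟩).symm.mono_left hYT⟩)
    have eL : S k ∪ X ∪ P = S k ∪ (D₁.biUnion S ∪ A₁) := by
      rw [← hPU, union_assoc, union_comm X]
    rw [eL] at tP
    have tQ := tP.union hQ.symm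
      (disjoint_union_left.2 ⟨s2, disjoint_union_left.2 ⟨s12,
        (hFA.2.2.1.mono_right hA₁).symm⟩⟩)
      (disjoint_union_left.2 ⟨disjoint_union_left.2 ⟨dYk.mono_right hQT, hQY.symm⟩,
        (disjoint_union_right.2 ⟨t12, hFB.2.1.mono_right hB₁⟩).mono_right hQT⟩)
    have eR : T k ∪ Y ∪ D₁.biUnion T ∪ Q = T k ∪ (D₁.biUnion T ∪ (D₂.biUnion T ∪ B₁)) := by
      rw [← hQU]
      ext x
      simp only [mem_union]
      tauto
    rw [eR] at tQ
    have dA : ∀ {K}, Disjoint K A₀ → Disjoint K (A₀ \ A₁) := fun hK => hK.mono_right sdiff_subset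
    have dB : ∀ {K}, Disjoint K B₀ → Disjoint K (B₀ \ B₁) := fun hK => hK.mono_right sdiff_subset
    have tfin := tQ.union key
      (by
        simp only [disjoint_union_left, disjoint_union_right]
        exact ⟨⟨⟨s3, s13, (hFA.2.2.2.mono_right hA₁).symm⟩, s23⟩,
          ⟨dA hFA.1, dA hFA.2.1, disjoint_sdiff⟩, dA hFA.2.2.1⟩)
      (by
        simp only [disjoint_union_left, disjoint_union_right]
        exact ⟨⟨t3, t13, t23, (hFB.2.2.2.mono_right hB₁).symm⟩,
          dB hFB.1, dB hFB.2.1, dB hFB.2.2.1, disjoint_sdiff⟩)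
    convert tfin using 1
    · conv_lhs => rw [← union_sdiff_of_subset hA₁]
      ext x
      simp only [mem_union]
      tauto
    · conv_lhs => rw [← union_sdiff_of_subset hB₁]
      ext x
      simp only [mem_union]
      tauto

end Routing

/-- Zhao's stability theorem: for every `α > 0` and integer
`r ≥ 1` there are `β > 0` and `m₁` such that for all `n = mr`, `m ≥ m₁`, any
balanced bipartite graph with parts of size `n` and `δ(G) ≥ (1/2 − β)n`
either can be tiled with `K_{r,r}` or is extremal with parameter `α`. -/
theorem zhao_stability (α : ℝ) (hα : 0 < α) (r : ℕ) (hr : 1 ≤ r) :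
    ∃ β : ℝ, 0 < β ∧ ∃ m₁ : ℕ, 1 ≤ m₁ ∧
      ∀ m : ℕ, m₁ ≤ m → ∀ n : ℕ, n = m * r →
      ∀ (V : Type) (_ : Fintype V) (_ : DecidableEq V),
      ∀ (G : SimpleGraph V) (A B : Finset V),
        IsBipartition G A B → A.card = n → B.card = n →
        (∀ v : V, ((1 : ℝ) / 2 - β) * n ≤ (degS G v Finset.univ : ℝ)) →
        KstTileable G r r ∨
          ∃ U₁' ⊆ A, ∃ V₂' ⊆ B,
            U₁'.card = n / 2 ∧ V₂'.card = n / 2 ∧ dens G U₁' V₂' ≤ α := by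
  have hrpos : (0 : ℝ) < r := by exact_mod_cast hr
  obtain ⟨κ, hκ, hκ1, hκα⟩ : ∃ κ : ℝ, 0 < κ ∧ κ ≤ 1 ∧ 72 * κ ≤ α :=
    ⟨min 1 (α / 72), by positivity, min_le_left _ _, by linarith [min_le_right 1 (α / 72)]⟩
  obtain ⟨h, hrh, hθ⟩ : ∃ h : ℕ, r ∣ h ∧ ((2 * r * r : ℕ) : ℝ) ≤ κ * h := by
    refine ⟨r * ⌈2 * r / κ⌉₊, dvd_mul_right _ _, ?_⟩
    have := (div_le_iff₀ hκ).1 (Nat.le_ceil (2 * r / κ))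
    push_cast
    nlinarith
  have hh : 2 * r * r ≤ h := by
    have : ((2 * r * r : ℕ) : ℝ) ≤ h :=
      hθ.trans (mul_le_of_le_one_left (by positivity) hκ1)
    exact_mod_cast this
  have hh1 : 1 ≤ h := by nlinarith
  obtain ⟨β, hβ, n₀, htile⟩ := exists_almost_perfect_tiling (ε := κ / (1 + 5 * h))
    (by positivity) (div_le_one_of_le₀ (by linarith [(Nat.cast_nonneg h : (0 : ℝ) ≤ h)])
      (by positivity)) hh1
  refine ⟨min β κ, lt_min hβ hκ, n₀ + ⌈h / κ⌉₊ + 2, by omega,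
    fun m hm n hnm V _ _ G A B hbip hA hB hdeg => ?_⟩
  have hmn : m ≤ n := hnm ▸ Nat.le_mul_of_pos_right _ hr
  have hhn : h ≤ κ * n := by
    rw [mul_comm, ← div_le_iff₀ hκ]
    exact (Nat.le_ceil _).trans (by exact_mod_cast (by omega : ⌈h / κ⌉₊ ≤ n))
  obtain ⟨hAB, hU, hadj⟩ := hbip
  have hdegA : ∀ a ∈ A, degS G a univ = degS G a B := fun a ha => by
    unfold degS
    congr 1
    ext w
    simp only [mem_filter, mem_univ, true_and]
    refine ⟨fun haw => ⟨?_, haw⟩, And.right⟩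
    rcases hadj a w haw with h | h
    exacts [h.2, absurd h.1 (disjoint_left.1 hAB ha)]
  have hdegB : ∀ b ∈ B, degS G b univ = degS G b A := fun b hb => by
    unfold degS
    congr 1
    ext w
    simp only [mem_filter, mem_univ, true_and]
    refine ⟨fun hbw => ⟨?_, hbw⟩, And.right⟩
    rcases hadj b w hbw with h | h
    exacts [absurd hb (disjoint_left.1 hAB h.1), h.2]
  have hle : ∀ c, min β κ ≤ c → ((1 : ℝ) / 2 - c) * n ≤ (1 / 2 - min β κ) * n := fun c hc => by
    gcongr
  have hdA : ∀ c, min β κ ≤ c → ∀ a ∈ A, ((1 : ℝ) / 2 - c) * n ≤ (degS G a B : ℝ) :=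
    fun c hc a ha => hdegA a ha ▸ (hle c hc).trans (hdeg a)
  have hdB : ∀ c, min β κ ≤ c → ∀ b ∈ B, ((1 : ℝ) / 2 - c) * n ≤ (degS G b A : ℝ) :=
    fun c hc b hb => hdegB b hb ▸ (hle c hc).trans (hdeg b)
  by_contra! hcon
  obtain ⟨hnot, hdens⟩ := hcon
  have hN : NonExtremal G A B n κ :=
    { cardL := hA
      cardR := hB
      degL := hdA κ (min_le_right _ _)
      degR := hdB κ (min_le_right _ _)
      dense := fun X hX Y hY hXc hYc => by
        have h1 := hdens X hX Y hY hXc hYc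
        have h2 : (n : ℝ) ≤ 3 * (n / 2 : ℕ) := by exact_mod_cast (by omega : n ≤ 3 * (n / 2))
        have h3 : (0 : ℝ) < (n / 2 : ℕ) := by exact_mod_cast (by omega : 0 < n / 2)
        unfold dens eAB at h1
        rw [hXc, hYc, lt_div_iff₀ (by positivity)] at h1
        refine lt_of_le_of_lt ?_ h1
        calc 8 * κ * (n : ℝ) ^ 2 ≤ 8 * κ * (3 * (n / 2 : ℕ)) ^ 2 := by gcongr
          _ = 72 * κ * ((n / 2 : ℕ) * (n / 2 : ℕ)) := by ring
          _ ≤ _ := by gcongr }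
  obtain ⟨ι, _, S, T, hF, hc, hleft⟩ := htile n (by omega) V inferInstance inferInstance G A B
    hA hB (hdA β (min_le_left _ _)) (hdB β (min_le_left _ _))
  have hcT : ∀ i, (T i).card = h := fun i => by rw [← hF.card_eq, hc]
  have hLA := hF.sum_card_add
  have hLB := hF.symm.sum_card_add
  simp only [hc, hcT, sum_const, smul_eq_mul, hA, hB] at hLA hLB
  obtain ⟨g, hg⟩ : r ∣ (A \ univ.biUnion S).card :=
    (Nat.dvd_add_right (hrh.mul_left _)).1 (hLA ▸ hnm ▸ dvd_mul_left r m)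
  have hg' : (B \ univ.biUnion T).card = r * g := by omega
  have hSA : univ.biUnion S ⊆ A := biUnion_subset.2 fun i _ => hF.subL i
  have hTB : univ.biUnion T ⊆ B := biUnion_subset.2 fun i _ => hF.subR i
  have key := hN.pairTileable hF hc hr hrh hh hκ.le hκ1 hθ hhn g (F := univ) sdiff_subset
    sdiff_subset hg hg' disjoint_sdiff disjoint_sdiff (by
      rw [hg] at hLA hleft
      have h1 : ((univ : Finset ι).card : ℝ) * h + r * g = n := by exact_mod_cast hLA
      rw [div_mul_eq_mul_div, le_div_iff₀ (by positivity)] at hleft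
      push_cast at hleft
      linarith)
  rw [union_sdiff_of_subset hSA, union_sdiff_of_subset hTB] at key
  exact hnot (key.kstTileable hAB hU)

end PaperTiling
end
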